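/- arXiv:1406.3419 — 4 statements merged into one kernel-verified Lean document; each statement's English description precedes it below -/
import Mathlib

section
/- There is an absolute constant C > 0 with the following property. Let V ∈ L¹_loc(ℝ³) be real-valued and periodic with respect to (2πℤ)³, let ε > 0, and for N ≥ 0 let V_N(x) = V(x) if |V(x)| > N and V_N(x) = 0 if |V(x)| ≤ N. If there exists N₀ such that ‖V_N χ_Ω‖_F < ε for all N ≥ N₀, then there is a finite constant K (depending on V, N₀ and ε) such that for every continuously differentiable compactly supported ψ : ℝ³ → ℂ, ∫_{ℝ³} |ψ(x)|² |V(x)| dx ≤ C ε ∫_{ℝ³} |∇ψ(x)|² dx + K ∫_{ℝ³} |ψ(x)|² dx. -/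
open MeasureTheory ENNReal NNReal Real Filter
open scoped Classical

noncomputable section

abbrev E3 : Type := EuclideanSpace ℝ (Fin 3)

/-- The axis-parallel cube in `ℝ³` centered at `z` with side length `r`. -/
def cube3 (z : E3) (r : ℝ) : Set E3 := {x : E3 | ∀ i, |x i - z i| ≤ r / 2}

/-- The Kerman–Sawyer ratio for the cube `Q(z,r)`. -/
def ksRatio (w : E3 → ℝ≥0∞) (z : E3) (r : ℝ) : ℝ≥0∞ :=
  (∫⁻ x in cube3 z r, w x)⁻¹ *
    ∫⁻ x in cube3 z r, ∫⁻ y in cube3 z r, w x * w y / edist x y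

/-- The Kerman–Sawyer norm `‖w‖_F` on `ℝ³`. -/
def ksNorm (w : E3 → ℝ≥0∞) : ℝ≥0∞ :=
  ⨆ (z : E3) (r : ℝ) (_ : 0 < r), ksRatio w z r

/-- Fractional integral of order 1 on `ℝ³`: `I₁ f x = ∫ f y / |x-y|² dy`. -/
def I1 (f : E3 → ℝ≥0∞) (x : E3) : ℝ≥0∞ := ∫⁻ y, f y / (edist x y) ^ 2

/-- Fractional integral of order 2 on `ℝ³`: `I₂ f x = ∫ f y / |x-y| dy`. -/
def I2 (f : E3 → ℝ≥0∞) (x : E3) : ℝ≥0∞ := ∫⁻ y, f y / edist x y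

/-- The fundamental cell `Ω = [0, 2π)³`. -/
def Ω3 : Set E3 := {x : E3 | ∀ i, 0 ≤ x i ∧ x i < 2 * π}

/-- Periodicity with respect to the lattice `(2πℤ)³`. -/
def Periodic3 {α : Type*} (w : E3 → α) : Prop :=
  ∀ (x : E3) (n : Fin 3 → ℤ),
    w (x + (WithLp.equiv 2 (Fin 3 → ℝ)).symm (fun i => 2 * π * n i)) = w x

/-- The Kerman–Sawyer norm on the torus. -/
def ksNormT (w : E3 → ℝ≥0∞) : ℝ≥0∞ :=
  ⨆ (z : E3) (_ : z ∈ Ω3) (r : ℝ) (_ : 0 < r) (_ : r < 4 * π), ksRatio w z r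

/-- Euclidean norm of a vector in `Fin 3 → ℝ`. -/
def norm3 (v : Fin 3 → ℝ) : ℝ := Real.sqrt (∑ i, (v i) ^ 2)

/-- The character `e^{i n·x}`. -/
def ewave (n : Fin 3 → ℤ) (x : E3) : ℂ :=
  Complex.exp (Complex.I * ((∑ i, (n i : ℝ) * x i : ℝ) : ℂ))

/-- The real quadratic form `v A vᵀ`. -/
def qA (A : Matrix (Fin 3) (Fin 3) ℝ) (v : Fin 3 → ℝ) : ℝ := ∑ i, ∑ j, v i * A i j * v j

/-- The sum of `φ` over the descendants of `i` (at level `k`) down to relative depth `n`, in the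
tree with children `ch`. -/
def descSum {ι M : Type*} [AddCommMonoid M] (ch : ι → Finset ι) (φ : ℕ → ι → M) :
    ℕ → ℕ → ι → M
  | 0, _, _ => 0
  | n + 1, k, i => φ k i + ∑ j ∈ ch i, descSum ch φ n (k + 1) j

theorem carleson_scalar {b G m s : ℝ} (hb : 0 ≤ b) (hm : 0 < m) (hs : 0 ≤ s)
    (h : b * m ^ 2 + s ≤ m) :
    b * G ^ 2 + 4 * (G ^ 2 / (m + (b * m ^ 2 + s))) ≤ 4 * (G ^ 2 / (m + s)) := by
  have ht : 0 < m + s := by positivity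
  have hT : 0 < m + (b * m ^ 2 + s) := by positivity
  have hbm : 0 ≤ b * m ^ 2 := by positivity
  have key : 4 * (G ^ 2 / (m + s)) - 4 * (G ^ 2 / (m + (b * m ^ 2 + s)))
      = 4 * G ^ 2 * b * m ^ 2 / ((m + s) * (m + (b * m ^ 2 + s))) := by
    field_simp
    ring
  have : b * G ^ 2 ≤ 4 * G ^ 2 * b * m ^ 2 / ((m + s) * (m + (b * m ^ 2 + s))) := by
    rw [le_div_iff₀ (by positivity)]
    have h1 : (m + s) * (m + (b * m ^ 2 + s)) ≤ (2 * m) * (2 * m) :=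
      mul_le_mul (by linarith) (by linarith) hT.le (by positivity)
    calc b * G ^ 2 * ((m + s) * (m + (b * m ^ 2 + s)))
        ≤ b * G ^ 2 * ((2 * m) * (2 * m)) := mul_le_mul_of_nonneg_left h1 (by positivity)
      _ = _ := by ring
  linarith

theorem carleson_step {ι : Type*} (J : Finset ι) (G m s : ι → ℝ≥0) (b : ℝ≥0)
    (hG : ∀ j, m j = 0 → G j = 0)
    (h : b * (∑ j ∈ J, m j) ^ 2 + ∑ j ∈ J, s j ≤ ∑ j ∈ J, m j) :
    b * (∑ j ∈ J, G j) ^ 2 +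
        4 * ((∑ j ∈ J, G j) ^ 2 / (∑ j ∈ J, m j + (b * (∑ j ∈ J, m j) ^ 2 + ∑ j ∈ J, s j)))
      ≤ ∑ j ∈ J, 4 * (G j ^ 2 / (m j + s j)) := by
  rcases eq_or_ne (∑ j ∈ J, m j) 0 with h0 | h0
  · have : ∑ j ∈ J, G j = 0 :=
      Finset.sum_eq_zero fun j hj => hG j ((Finset.sum_eq_zero_iff.mp h0) j hj)
    simp [this]
  have hpos : 0 < ∑ j ∈ J, m j := pos_iff_ne_zero.mpr h0
  have titu : (∑ j ∈ J, G j) ^ 2 / (∑ j ∈ J, m j + ∑ j ∈ J, s j)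
      ≤ ∑ j ∈ J, G j ^ 2 / (m j + s j) := by
    apply div_le_of_le_mul₀ (by positivity) (by positivity)
    rw [← Finset.sum_add_distrib]
    refine Finset.sum_sq_le_sum_mul_sum_of_sq_le_mul J (fun _ _ => by positivity)
      (fun _ _ => by positivity) fun j _ => ?_
    rcases eq_or_ne (m j) 0 with hj | hj
    · simp [hG j hj]
    · rw [div_mul_cancel₀]
      positivity
  rw [← Finset.mul_sum]
  refine le_trans ?_ (mul_le_mul_of_nonneg_left titu (by positivity))
  rw [← NNReal.coe_le_coe] at h ⊢
  push_cast at h ⊢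
  have hpos' : (0 : ℝ) < ∑ j ∈ J, (m j : ℝ) := by exact_mod_cast hpos
  exact carleson_scalar b.2 hpos' (by positivity) h

/-- The Carleson embedding theorem on a tree. -/
theorem carleson_embedding {ι : Type*} (ch : ι → Finset ι) (G m F : ℕ → ι → ℝ≥0) (b : ℕ → ℝ≥0)
    (hG : ∀ k i, G k i = ∑ j ∈ ch i, G (k + 1) j)
    (hm : ∀ k i, m k i = ∑ j ∈ ch i, m (k + 1) j)
    (hF : ∀ k i, F k i = ∑ j ∈ ch i, F (k + 1) j)
    (hGF : ∀ k i, G k i ^ 2 ≤ m k i * F k i)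
    (htest : ∀ n k i, descSum ch (fun k i => b k * m k i ^ 2) n k i ≤ m k i) (n k : ℕ) (i : ι) :
    descSum ch (fun k i => b k * G k i ^ 2) n k i ≤ 4 * F k i := by
  have hG0 : ∀ k i, m k i = 0 → G k i = 0 := fun k i h => by
    have := hGF k i
    rw [h, zero_mul] at this
    exact pow_eq_zero_iff (two_ne_zero) |>.mp (le_antisymm this zero_le)
  suffices H : ∀ n k i, descSum ch (fun k i => b k * G k i ^ 2) n k i
      + 4 * (G k i ^ 2 / (m k i + descSum ch (fun k i => b k * m k i ^ 2) n k i)) ≤ 4 * F k i from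
    le_trans le_self_add (H n k i)
  intro n
  induction n with
  | zero =>
    intro k i
    simp only [descSum, zero_add, add_zero]
    gcongr
    exact div_le_of_le_mul₀ (by positivity) (by positivity) (by rw [mul_comm]; exact hGF k i)
  | succ n ih =>
    intro k i
    have h1 := htest (n + 1) k i
    simp only [descSum] at h1 ⊢
    rw [hF k i, Finset.mul_sum, hG k i]
    rw [hm k i] at h1 ⊢
    refine le_trans ?_ (Finset.sum_le_sum fun j _ => ih (k + 1) j)
    rw [Finset.sum_add_distrib, add_right_comm, add_comm]
    exact add_le_add le_rfl (carleson_step (ch i) (G (k + 1)) (m (k + 1)) _ (b k)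
      (hG0 (k + 1)) h1)

/-- The side length of the dyadic subcells of `Ω3` at level `k`. -/
def side (k : ℕ) : ℝ := 2 * π / 2 ^ k

theorem side_pos (k : ℕ) : 0 < side k := by unfold side; positivity

theorem side_succ (k : ℕ) : side k = 2 * side (k + 1) := by
  unfold side; field_simp; ring

/-- The index of the dyadic cell at level `k` containing `x`. -/
def addr (k : ℕ) (x : E3) : Fin 3 → ℤ := fun i => ⌊x i / side k⌋

/-- The half-open dyadic cell at level `k` with index `m`. -/
def cell (k : ℕ) (m : Fin 3 → ℤ) : Set E3 := {x | addr k x = m}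

theorem mem_cell {k : ℕ} {m : Fin 3 → ℤ} {x : E3} : x ∈ cell k m ↔ addr k x = m := Iff.rfl

theorem mem_cell_addr (k : ℕ) (x : E3) : x ∈ cell k (addr k x) := rfl

theorem mem_cell_iff {k : ℕ} {m : Fin 3 → ℤ} {x : E3} :
    x ∈ cell k m ↔ ∀ i, m i * side k ≤ x i ∧ x i < (m i + 1) * side k := by
  simp only [mem_cell, funext_iff, addr, Int.floor_eq_iff, le_div_iff₀ (side_pos k),
    div_lt_iff₀ (side_pos k)]

theorem measurable_addr (k : ℕ) : Measurable (addr k) := by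
  refine measurable_pi_lambda _ fun i => Int.measurable_floor.comp ?_
  fun_prop

theorem measurableSet_cell (k : ℕ) (m : Fin 3 → ℤ) : MeasurableSet (cell k m) :=
  measurable_addr k (measurableSet_singleton m)

theorem convex_cell (k : ℕ) (m : Fin 3 → ℤ) : Convex ℝ (cell k m) := by
  intro x hx y hy a b ha hb hab
  rw [mem_cell_iff] at *
  intro i
  have h := (convex_Ico (𝕜 := ℝ) (m i * side k) ((m i + 1) * side k)) (hx i) (hy i) ha hb hab
  simpa using h

theorem edist_le_of_mem_cell {k : ℕ} {m : Fin 3 → ℤ} {x y : E3} (hx : x ∈ cell k m)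
    (hy : y ∈ cell k m) : edist x y ≤ ENNReal.ofReal (2 * side k) := by
  rw [edist_dist]
  apply ENNReal.ofReal_le_ofReal
  rw [EuclideanSpace.dist_eq]
  have hs := side_pos k
  apply Real.sqrt_le_iff.mpr ⟨by positivity, ?_⟩
  rw [mem_cell_iff] at hx hy
  have : ∀ i, dist (x i) (y i) ^ 2 ≤ side k ^ 2 := fun i => by
    rw [Real.dist_eq, sq_abs]
    have := hx i
    have := hy i
    exact sq_le_sq' (by linarith) (by linarith)
  calc ∑ i, dist (x i) (y i) ^ 2 ≤ ∑ _i : Fin 3, side k ^ 2 := Finset.sum_le_sum fun i _ => this i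
    _ = 3 * side k ^ 2 := by simp
    _ ≤ _ := by nlinarith

theorem cell_eq_preimage (k : ℕ) (m : Fin 3 → ℤ) :
    cell k m = WithLp.ofLp ⁻¹' (Set.univ.pi fun i => Set.Ico (m i * side k) ((m i + 1) * side k)) := by
  ext x
  simp [mem_cell_iff]

theorem volume_cell (k : ℕ) (m : Fin 3 → ℤ) : volume (cell k m) = ENNReal.ofReal (side k) ^ 3 := by
  rw [cell_eq_preimage, (PiLp.volume_preserving_ofLp (Fin 3)).measure_preimage
    (MeasurableSet.univ_pi fun _ => measurableSet_Ico).nullMeasurableSet, Real.volume_pi_Ico]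
  have : ∀ i, ((m i : ℝ) + 1) * side k - m i * side k = side k := fun i => by ring
  simp [this]

/-- The centre of a dyadic cell. -/
def center (k : ℕ) (m : Fin 3 → ℤ) : E3 := WithLp.toLp 2 fun i => (m i + 1 / 2) * side k

theorem cell_ae_eq_cube3 (k : ℕ) (m : Fin 3 → ℤ) :
    cell k m =ᵐ[volume] cube3 (center k m) (side k) := by
  have h : cube3 (center k m) (side k) = WithLp.ofLp ⁻¹'
      (Set.Icc (fun i => m i * side k) fun i => (m i + 1) * side k) := by
    ext x
    simp only [cube3, center, Set.mem_ofPred_eq, Set.mem_preimage, Set.mem_Icc, Pi.le_def,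
      ← forall_and, abs_le]
    refine forall_congr' fun i => ?_
    constructor <;> rintro ⟨h1, h2⟩ <;> constructor <;> linarith
  rw [h, cell_eq_preimage]
  exact (PiLp.volume_preserving_ofLp (Fin 3)).quasiMeasurePreserving.preimage_ae_eq
    Measure.univ_pi_Ico_ae_eq_Icc

theorem addr_succ_div (k : ℕ) (x : E3) (i : Fin 3) : addr (k + 1) x i / 2 = addr k x i := by
  have h : x i / side k = x i / side (k + 1) / (2 : ℕ) := by
    rw [side_succ k]; push_cast; field_simp
  unfold addr
  rw [h, Int.floor_div_natCast]
  rfl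

theorem addr_eq_of_le {k l : ℕ} (hkl : k ≤ l) {x y : E3} (h : addr l x = addr l y) :
    addr k x = addr k y := by
  induction l, hkl using Nat.le_induction with
  | base => exact h
  | succ l _ ih =>
    refine ih (funext fun i => ?_)
    rw [← addr_succ_div l x, ← addr_succ_div l y, h]

theorem cell_addr_subset {k l : ℕ} (hkl : k ≤ l) (x : E3) :
    cell l (addr l x) ⊆ cell k (addr k x) := fun _ hy => addr_eq_of_le hkl hy

/-- The indices of the eight dyadic children of a cell. -/
def children (m : Fin 3 → ℤ) : Finset (Fin 3 → ℤ) :=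
  Fintype.piFinset fun i => {2 * m i, 2 * m i + 1}

theorem mem_children {m j : Fin 3 → ℤ} : j ∈ children m ↔ ∀ i, j i / 2 = m i := by
  simp only [children, Fintype.mem_piFinset, Finset.mem_insert, Finset.mem_singleton]
  exact forall_congr' fun i => by omega

theorem cell_eq_biUnion_children (k : ℕ) (m : Fin 3 → ℤ) :
    cell k m = ⋃ j ∈ children m, cell (k + 1) j := by
  ext x
  simp only [Set.mem_iUnion, mem_cell, exists_prop, exists_eq_right', mem_children,
    addr_succ_div]
  exact funext_iff

theorem disjoint_cell (k : ℕ) {m n : Fin 3 → ℤ} (h : m ≠ n) : Disjoint (cell k m) (cell k n) :=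
  Set.disjoint_left.mpr fun _ hx hy => h (hx.symm.trans hy)

theorem lintegral_cell_eq_sum_children (μ : Measure E3) (f : E3 → ℝ≥0∞) (k : ℕ)
    (m : Fin 3 → ℤ) :
    ∫⁻ x in cell k m, f x ∂μ = ∑ j ∈ children m, ∫⁻ x in cell (k + 1) j, f x ∂μ := by
  rw [cell_eq_biUnion_children, lintegral_biUnion_finset
    (fun _ _ _ _ h => disjoint_cell _ h) (fun _ _ => measurableSet_cell _ _)]

theorem lintegral_eq_tsum_cell (μ : Measure E3) (f : E3 → ℝ≥0∞) (k : ℕ) :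
    ∫⁻ x, f x ∂μ = ∑' m, ∫⁻ x in cell k m, f x ∂μ := by
  rw [← lintegral_iUnion (fun m => measurableSet_cell k m) (fun _ _ h => disjoint_cell k h)]
  have : ⋃ m, cell k m = Set.univ := by ext x; simp [mem_cell]
  rw [this, Measure.restrict_univ]

theorem lintegral_cell_mul_addr (μ : Measure E3) {f : E3 → ℝ≥0∞} (hf : Measurable f)
    (c : (Fin 3 → ℤ) → ℝ≥0∞) (k : ℕ) (m : Fin 3 → ℤ) :
    ∫⁻ x in cell k m, f x * c (addr k x) ∂μ = (∫⁻ x in cell k m, f x ∂μ) * c m := by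
  rw [← lintegral_mul_const _ hf]
  refine setLIntegral_congr_fun (measurableSet_cell k m) fun x hx => ?_
  simp only [mem_cell.mp hx]

theorem lintegral_mul_addr (μ : Measure E3) {f : E3 → ℝ≥0∞} (hf : Measurable f)
    (c : (Fin 3 → ℤ) → ℝ≥0∞) (k : ℕ) :
    ∫⁻ x, f x * c (addr k x) ∂μ = ∑' m, (∫⁻ x in cell k m, f x ∂μ) * c m := by
  simp_rw [lintegral_eq_tsum_cell μ _ k, lintegral_cell_mul_addr μ hf]

/-- Averaging over dyadic cells is symmetric. -/
theorem lintegral_mul_lintegral_cell_comm (μ ν : Measure E3) {f g : E3 → ℝ≥0∞}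
    (hf : Measurable f) (hg : Measurable g) (k : ℕ) :
    ∫⁻ x, f x * ∫⁻ y in cell k (addr k x), g y ∂ν ∂μ
      = ∫⁻ y, g y * ∫⁻ x in cell k (addr k y), f x ∂μ ∂ν := by
  rw [lintegral_mul_addr μ hf (fun m => ∫⁻ y in cell k m, g y ∂ν),
    lintegral_mul_addr ν hg (fun m => ∫⁻ y in cell k m, f y ∂μ)]
  exact tsum_congr fun m => mul_comm _ _

theorem measurable_addr_comp (c : (Fin 3 → ℤ) → ℝ≥0∞) (k : ℕ) :
    Measurable fun x => c (addr k x) :=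
  (measurable_of_countable c).comp (measurable_addr k)

theorem Ω3_eq_cell : Ω3 = cell 0 0 := by
  ext x
  simp [Ω3, mem_cell_iff, side]

theorem lintegral_comp_contraction_le {Q : Set E3} (hQ : MeasurableSet Q) (hc : Convex ℝ Q)
    {F : E3 → ℝ≥0∞} (hF : Measurable F) {a b : ℝ} (ha : 1 / 2 ≤ a) (hb : 0 ≤ b) (hab : a + b = 1)
    {z : E3} (hz : z ∈ Q) :
    ∫⁻ y in Q, F (a • y + b • z) ≤ 8 * ∫⁻ y in Q, F y := by
  have ha0 : 0 < a := by linarith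
  have hH : Measurable (Q.indicator F) := hF.indicator hQ
  calc ∫⁻ y in Q, F (a • y + b • z)
      = ∫⁻ y in Q, Q.indicator F (a • y + b • z) := by
        refine setLIntegral_congr_fun hQ fun y hy => ?_
        simp only [Set.indicator_of_mem (hc hy hz ha0.le hb hab)]
    _ ≤ ∫⁻ y, Q.indicator F (a • y + b • z) := setLIntegral_le_lintegral _ _
    _ = ∫⁻ u, Q.indicator F (u + b • z) ∂(Measure.map (fun y : E3 => a • y) volume) := by
        rw [lintegral_map (by fun_prop) (by fun_prop)]
    _ = ENNReal.ofReal |(a ^ 3)⁻¹| * ∫⁻ y in Q, F y := by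
        rw [Measure.map_addHaar_smul _ ha0.ne', lintegral_smul_measure, finrank_euclideanSpace_fin,
          lintegral_add_right_eq_self (Q.indicator F) (b • z), lintegral_indicator hQ, smul_eq_mul]
    _ ≤ 8 * ∫⁻ y in Q, F y := by
        gcongr
        rw [abs_of_pos (by positivity), ← ENNReal.ofReal_ofNat]
        apply ENNReal.ofReal_le_ofReal
        rw [inv_le_comm₀ (by positivity) (by norm_num)]
        calc (8 : ℝ)⁻¹ = (1 / 2) ^ 3 := by norm_num
          _ ≤ a ^ 3 := by gcongr

theorem enorm_sub_le_lintegral_fderiv {ψ : E3 → ℂ} (hψ : ContDiff ℝ 1 ψ) (y z : E3) :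
    ‖ψ y - ψ z‖ₑ ≤
      (∫⁻ t in Set.Ioc (0 : ℝ) 1, ‖fderiv ℝ ψ ((1 - t) • y + t • z)‖ₑ) * edist y z := by
  have hd : ∀ t : ℝ, HasDerivAt (fun t : ℝ => ψ ((1 - t) • y + t • z))
      (fderiv ℝ ψ ((1 - t) • y + t • z) (z - y)) t := fun t => by
    have h1 : HasDerivAt (fun t : ℝ => (1 - t) • y + t • z) (z - y) t := by
      have := (((hasDerivAt_id t).const_sub 1).smul_const y).add ((hasDerivAt_id t).smul_const z)
      convert! this using 1
      simp [sub_eq_add_neg, add_comm]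
    exact ((hψ.differentiable one_ne_zero _).hasFDerivAt).comp_hasDerivAt t h1
  have hcont : Continuous fun t : ℝ => fderiv ℝ ψ ((1 - t) • y + t • z) (z - y) :=
    ((hψ.continuous_fderiv one_ne_zero).comp (by fun_prop)).clm_apply continuous_const
  have hftc := intervalIntegral.integral_eq_sub_of_hasDerivAt (a := 0) (b := 1)
    (fun t _ => hd t) (hcont.intervalIntegrable 0 1)
  simp only [sub_self, zero_smul, one_smul, zero_add, sub_zero, add_zero] at hftc
  rw [← neg_sub, enorm_neg, ← hftc, intervalIntegral.integral_of_le zero_le_one,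
    edist_comm, edist_eq_enorm_sub, ← lintegral_mul_const' _ _ enorm_ne_top]
  exact (enorm_integral_le_lintegral_enorm _).trans
    (lintegral_mono fun t => ContinuousLinearMap.le_opENorm _ _)

/-- An `L¹` Poincaré inequality on convex sets. -/
theorem lintegral_lintegral_enorm_sub_le {Q : Set E3} (hQ : MeasurableSet Q) (hc : Convex ℝ Q)
    {d : ℝ≥0∞} (hd : ∀ x ∈ Q, ∀ y ∈ Q, edist x y ≤ d) {ψ : E3 → ℂ} (hψ : ContDiff ℝ 1 ψ) :
    ∫⁻ y in Q, ∫⁻ z in Q, ‖ψ y - ψ z‖ₑ ≤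
      8 * d * volume Q * ∫⁻ y in Q, ‖fderiv ℝ ψ y‖ₑ := by
  have hF : Measurable fun y => ‖fderiv ℝ ψ y‖ₑ :=
    (hψ.continuous_fderiv one_ne_zero).enorm.measurable
  set F := fun y => ‖fderiv ℝ ψ y‖ₑ with hFdef
  have hM : Measurable fun p : (E3 × E3) × ℝ => F ((1 - p.2) • p.1.1 + p.2 • p.1.2) :=
    hF.comp (by fun_prop)
  have hM1 : ∀ S : Set ℝ,
      Measurable fun p : E3 × E3 => ∫⁻ t in S, F ((1 - t) • p.1 + t • p.2) := fun S =>
    hM.lintegral_prod_right'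
  have hM2 : ∀ (S : Set ℝ) (y : E3),
      Measurable fun z => ∫⁻ t in S, F ((1 - t) • y + t • z) := fun S y =>
    (hF.comp (f := fun p : E3 × ℝ => (1 - p.2) • y + p.2 • p.1) (by fun_prop)).lintegral_prod_right'
  have hhalf : volume (Set.Ioc (0 : ℝ) (1 / 2)) = 2⁻¹ := by
    rw [Real.volume_Ioc, sub_zero, one_div, ENNReal.ofReal_inv_of_pos two_pos, ENNReal.ofReal_ofNat]
  have hhalf' : volume (Set.Ioc (1 / 2 : ℝ) 1) = 2⁻¹ := by
    rw [Real.volume_Ioc, ← ENNReal.ofReal_ofNat, ← ENNReal.ofReal_inv_of_pos two_pos]; norm_num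
  have hleft : ∫⁻ y in Q, ∫⁻ z in Q, ∫⁻ t in Set.Ioc (0 : ℝ) (1 / 2), F ((1 - t) • y + t • z)
      ≤ 4 * volume Q * ∫⁻ y in Q, F y := by
    rw [lintegral_lintegral_swap (hM1 _).aemeasurable]
    calc _ ≤ ∫⁻ _z in Q, 4 * ∫⁻ y in Q, F y := by
          refine setLIntegral_mono measurable_const fun z hz => ?_
          rw [lintegral_lintegral_swap
            (by exact (hF.comp (f := fun p : E3 × ℝ => (1 - p.2) • p.1 + p.2 • z)
              (by fun_prop)).aemeasurable)]
          calc _ ≤ ∫⁻ _t in Set.Ioc (0 : ℝ) (1 / 2), 8 * ∫⁻ y in Q, F y := by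
                refine setLIntegral_mono measurable_const fun t ht => ?_
                exact lintegral_comp_contraction_le hQ hc hF (by linarith [ht.2]) ht.1.le
                  (by ring) hz
            _ = (8 * 2⁻¹) * ∫⁻ y in Q, F y := by
                rw [setLIntegral_const, hhalf]; ring
            _ = _ := by
                congr 1
                rw [show (8 : ℝ≥0∞) = 4 * 2 by norm_num, mul_assoc,
                  ENNReal.mul_inv_cancel two_ne_zero ofNat_ne_top, mul_one]
      _ = _ := by rw [setLIntegral_const]; ring
  have hright : ∫⁻ y in Q, ∫⁻ z in Q, ∫⁻ t in Set.Ioc (1 / 2 : ℝ) 1, F ((1 - t) • y + t • z)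
      ≤ 4 * volume Q * ∫⁻ y in Q, F y := by
    calc _ ≤ ∫⁻ _y in Q, 4 * ∫⁻ y in Q, F y := by
          refine setLIntegral_mono measurable_const fun y hy => ?_
          rw [lintegral_lintegral_swap
            (by exact (hF.comp (f := fun p : E3 × ℝ => (1 - p.2) • y + p.2 • p.1)
              (by fun_prop)).aemeasurable)]
          calc _ ≤ ∫⁻ _t in Set.Ioc (1 / 2 : ℝ) 1, 8 * ∫⁻ y in Q, F y := by
                refine setLIntegral_mono measurable_const fun t ht => ?_
                simp_rw [add_comm ((1 - t) • y)]
                exact lintegral_comp_contraction_le hQ hc hF ht.1.le (by linarith [ht.2])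
                  (by ring) hy
            _ = (8 * 2⁻¹) * ∫⁻ y in Q, F y := by
                rw [setLIntegral_const, hhalf']; ring
            _ = _ := by
                congr 1
                rw [show (8 : ℝ≥0∞) = 4 * 2 by norm_num, mul_assoc,
                  ENNReal.mul_inv_cancel two_ne_zero ofNat_ne_top, mul_one]
      _ = _ := by rw [setLIntegral_const]; ring
  have hsplit : ∀ y z : E3, ∫⁻ t in Set.Ioc (0 : ℝ) 1, F ((1 - t) • y + t • z)
      = (∫⁻ t in Set.Ioc (0 : ℝ) (1 / 2), F ((1 - t) • y + t • z))
        + ∫⁻ t in Set.Ioc (1 / 2 : ℝ) 1, F ((1 - t) • y + t • z) := fun y z => by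
    rw [← lintegral_union measurableSet_Ioc (Set.Ioc_disjoint_Ioc_of_le le_rfl),
      Set.Ioc_union_Ioc_eq_Ioc (by norm_num) (by norm_num)]
  calc ∫⁻ y in Q, ∫⁻ z in Q, ‖ψ y - ψ z‖ₑ
      ≤ ∫⁻ y in Q, ∫⁻ z in Q, (∫⁻ t in Set.Ioc (0 : ℝ) 1, F ((1 - t) • y + t • z)) * d := by
        refine setLIntegral_mono' hQ fun y hy => setLIntegral_mono' hQ fun z hz => ?_
        refine (enorm_sub_le_lintegral_fderiv hψ y z).trans ?_
        gcongr
        exact hd y hy z hz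
    _ = (∫⁻ y in Q, ∫⁻ z in Q, ∫⁻ t in Set.Ioc (0 : ℝ) 1, F ((1 - t) • y + t • z)) * d := by
        rw [← lintegral_mul_const _ (hM1 _).lintegral_prod_right']
        refine lintegral_congr fun y => ?_
        rw [lintegral_mul_const _ (hM2 _ y)]
    _ ≤ (4 * volume Q * (∫⁻ y in Q, F y) + 4 * volume Q * ∫⁻ y in Q, F y) * d := by
        gcongr
        simp_rw [hsplit]
        calc _ = (∫⁻ y in Q, ∫⁻ z in Q,
                ∫⁻ t in Set.Ioc (0 : ℝ) (1 / 2), F ((1 - t) • y + t • z))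
              + ∫⁻ y in Q, ∫⁻ z in Q,
                ∫⁻ t in Set.Ioc (1 / 2 : ℝ) 1, F ((1 - t) • y + t • z) := by
              rw [← lintegral_add_left (hM1 _).lintegral_prod_right']
              refine lintegral_congr fun y => ?_
              rw [lintegral_add_left (hM2 _ y)]
          _ ≤ _ := add_le_add hleft hright
    _ = 8 * d * volume Q * ∫⁻ y in Q, F y := by ring

/-- The side length of the dyadic cells at level `k`, as an extended nonnegative real. -/
def esize (k : ℕ) : ℝ≥0∞ := ENNReal.ofReal (side k)

theorem esize_ne_zero (k : ℕ) : esize k ≠ 0 := by simp [esize, side_pos k]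

theorem esize_ne_top (k : ℕ) : esize k ≠ ∞ := ENNReal.ofReal_ne_top

theorem esize_succ (k : ℕ) : esize k = 2 * esize (k + 1) := by
  rw [esize, side_succ, ENNReal.ofReal_mul two_pos.le, ENNReal.ofReal_ofNat, esize]

theorem inv_esize_mul (k : ℕ) : (esize k)⁻¹ * esize k = 1 :=
  ENNReal.inv_mul_cancel (esize_ne_zero k) (esize_ne_top k)

theorem inv_esize_succ (k : ℕ) : (esize (k + 1))⁻¹ = 2 * (esize k)⁻¹ := by
  rw [esize_succ k, ENNReal.mul_inv (by simp) (by simp), ← mul_assoc,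
    ENNReal.mul_inv_cancel two_ne_zero ofNat_ne_top, one_mul]

theorem esize_add (k j : ℕ) : esize (j + k) = esize k * 2⁻¹ ^ j := by
  induction j with
  | zero => simp
  | succ j ih =>
    have h : esize (j + k) = 2 * esize (j + 1 + k) := by
      rw [esize_succ, show j + k + 1 = j + 1 + k by ring]
    rw [pow_succ, ← mul_assoc, ← ih, h, mul_comm 2, mul_assoc,
      ENNReal.mul_inv_cancel two_ne_zero ofNat_ne_top, mul_one]

theorem volume_cell_eq_esize (k : ℕ) (m : Fin 3 → ℤ) : volume (cell k m) = esize k ^ 3 :=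
  volume_cell k m

/-- The average of `‖ψ‖` over the dyadic cell at level `k` containing `x`. -/
def cellAvg (ψ : E3 → ℂ) (k : ℕ) (x : E3) : ℝ≥0∞ :=
  (esize k)⁻¹ ^ 3 * ∫⁻ y in cell k (addr k x), ‖ψ y‖ₑ

theorem cellAvg_succ_le {ψ : E3 → ℂ} (hψ : ContDiff ℝ 1 ψ) (k : ℕ) (x : E3) :
    cellAvg ψ (k + 1) x ≤
      cellAvg ψ k x + 128 * ((esize k)⁻¹ ^ 2 * ∫⁻ y in cell k (addr k x), ‖fderiv ℝ ψ y‖ₑ) := by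
  set Q := cell k (addr k x)
  set Q' := cell (k + 1) (addr (k + 1) x)
  have hsub : Q' ⊆ Q := cell_addr_subset (Nat.le_succ k) x
  have hm : Measurable fun y => ‖ψ y‖ₑ := hψ.continuous.enorm.measurable
  have hP := lintegral_lintegral_enorm_sub_le (measurableSet_cell k (addr k x))
    (convex_cell k (addr k x)) (fun y hy z hz => edist_le_of_mem_cell hy hz) hψ
  rw [ENNReal.ofReal_mul two_pos.le, ENNReal.ofReal_ofNat, volume_cell_eq_esize] at hP
  change _ ≤ 8 * (2 * esize k) * esize k ^ 3 * _ at hP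
  have hmain : esize k ^ 3 * ∫⁻ y in Q', ‖ψ y‖ₑ ≤ esize (k + 1) ^ 3 * (∫⁻ z in Q, ‖ψ z‖ₑ)
      + 8 * (2 * esize k) * esize k ^ 3 * ∫⁻ y in Q, ‖fderiv ℝ ψ y‖ₑ := by
    calc esize k ^ 3 * ∫⁻ y in Q', ‖ψ y‖ₑ
        = ∫⁻ y in Q', ∫⁻ _z in Q, ‖ψ y‖ₑ := by
          rw [← lintegral_const_mul _ hm]
          refine lintegral_congr fun y => ?_
          rw [setLIntegral_const, volume_cell_eq_esize, mul_comm]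
      _ ≤ ∫⁻ y in Q', ((∫⁻ z in Q, ‖ψ z‖ₑ) + ∫⁻ z in Q, ‖ψ y - ψ z‖ₑ) := by
          refine lintegral_mono fun y => ?_
          rw [← lintegral_add_left hm]
          refine lintegral_mono fun z => ?_
          calc ‖ψ y‖ₑ = ‖ψ z + (ψ y - ψ z)‖ₑ := by rw [add_sub_cancel]
            _ ≤ _ := enorm_add_le _ _
      _ = esize (k + 1) ^ 3 * (∫⁻ z in Q, ‖ψ z‖ₑ) + ∫⁻ y in Q', ∫⁻ z in Q, ‖ψ y - ψ z‖ₑ := by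
          rw [lintegral_add_left measurable_const, setLIntegral_const, volume_cell_eq_esize,
            mul_comm]
      _ ≤ _ := add_le_add le_rfl ((lintegral_mono_set hsub).trans hP)
  have h1 := inv_esize_mul k
  have h2 := inv_esize_mul (k + 1)
  have h3 := inv_esize_succ k
  unfold cellAvg
  generalize (∫⁻ y in Q', ‖ψ y‖ₑ) = a at *
  generalize (∫⁻ y in Q, ‖ψ y‖ₑ) = b at *
  generalize (∫⁻ y in Q, ‖fderiv ℝ ψ y‖ₑ) = c at *
  generalize (esize k)⁻¹ = j at *
  generalize (esize (k + 1))⁻¹ = j' at *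
  generalize esize k = l at *
  generalize esize (k + 1) = l' at *
  calc j' ^ 3 * a = j' ^ 3 * (j * l) ^ 3 * a := by rw [h1]; ring
    _ = j' ^ 3 * j ^ 3 * (l ^ 3 * a) := by ring
    _ ≤ j' ^ 3 * j ^ 3 * (l' ^ 3 * b + 8 * (2 * l) * l ^ 3 * c) := by gcongr
    _ = (j' * l') ^ 3 * (j ^ 3 * b) + 16 * (j' ^ 3 * l * (j * l) ^ 3 * c) := by ring
    _ = j ^ 3 * b + 128 * (j ^ 2 * (j * l) ^ 4 * c) := by rw [h2, h3]; ring
    _ = _ := by rw [h1]; ring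

theorem cellAvg_le_tsum {ψ : E3 → ℂ} (hψ : ContDiff ℝ 1 ψ) (n : ℕ) (x : E3) :
    cellAvg ψ n x ≤ cellAvg ψ 0 x +
      128 * ∑' k, (esize k)⁻¹ ^ 2 * ∫⁻ y in cell k (addr k x), ‖fderiv ℝ ψ y‖ₑ := by
  have h : ∀ n, cellAvg ψ n x ≤ cellAvg ψ 0 x + 128 * ∑ k ∈ Finset.range n,
      (esize k)⁻¹ ^ 2 * ∫⁻ y in cell k (addr k x), ‖fderiv ℝ ψ y‖ₑ := by
    intro n
    induction n with
    | zero => simp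
    | succ n ih =>
      rw [Finset.sum_range_succ, mul_add, ← add_assoc]
      exact (cellAvg_succ_le hψ n x).trans (add_le_add ih le_rfl)
  refine (h n).trans ?_
  gcongr
  exact ENNReal.sum_le_tsum _

theorem exists_esize_lt {η : ℝ≥0∞} (hη : 0 < η) : ∃ n, 2 * esize n < η := by
  have h : Tendsto (fun n => 2 * esize n) atTop (nhds 0) := by
    have : (fun n => 2 * esize n) = fun n => (2 * esize 0) * 2⁻¹ ^ n :=
      funext fun n => by rw [← add_zero n, esize_add 0 n, mul_assoc, add_zero]
    rw [this, ← mul_zero (2 * esize 0)]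
    exact ENNReal.Tendsto.const_mul
      (ENNReal.tendsto_pow_atTop_nhds_zero_of_lt_one (by simp))
      (Or.inr (ENNReal.mul_ne_top ofNat_ne_top (esize_ne_top 0)))
  exact (h.eventually (gt_mem_nhds hη)).exists

/-- A dyadic version of the bound of a function by the fractional integral of its gradient. -/
theorem enorm_le_cellAvg_add_tsum {ψ : E3 → ℂ} (hψ : ContDiff ℝ 1 ψ) (x : E3) :
    ‖ψ x‖ₑ ≤ cellAvg ψ 0 x +
      128 * ∑' k, (esize k)⁻¹ ^ 2 * ∫⁻ y in cell k (addr k x), ‖fderiv ℝ ψ y‖ₑ := by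
  refine ENNReal.le_of_forall_pos_le_add fun δ hδ _ => ?_
  obtain ⟨η, hη, hη'⟩ := EMetric.continuous_iff.mp hψ.continuous x δ (by exact_mod_cast hδ)
  obtain ⟨n, hn⟩ := exists_esize_lt hη
  refine le_trans ?_ (add_le_add (cellAvg_le_tsum hψ n x) le_rfl)
  have hclose : ∀ y ∈ cell n (addr n x), ‖ψ x‖ₑ ≤ ‖ψ y‖ₑ + δ := fun y hy => by
    have h1 := edist_le_of_mem_cell hy (mem_cell_addr n x)
    rw [ENNReal.ofReal_mul two_pos.le, ENNReal.ofReal_ofNat] at h1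
    have h2 := hη' y (h1.trans_lt hn)
    rw [edist_comm, edist_eq_enorm_sub] at h2
    calc ‖ψ x‖ₑ = ‖ψ y + (ψ x - ψ y)‖ₑ := by rw [add_sub_cancel]
      _ ≤ _ := (enorm_add_le _ _).trans (add_le_add le_rfl h2.le)
  have hone : (esize n)⁻¹ ^ 3 * esize n ^ 3 = 1 := by rw [← mul_pow, inv_esize_mul, one_pow]
  calc ‖ψ x‖ₑ = (esize n)⁻¹ ^ 3 * ∫⁻ _y in cell n (addr n x), ‖ψ x‖ₑ := by
        rw [setLIntegral_const, volume_cell_eq_esize, mul_left_comm, hone, mul_one]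
    _ ≤ (esize n)⁻¹ ^ 3 * ∫⁻ y in cell n (addr n x), (‖ψ y‖ₑ + δ) := by
        exact mul_le_mul' le_rfl (setLIntegral_mono' (measurableSet_cell _ _) hclose)
    _ = cellAvg ψ n x + δ := by
        rw [lintegral_add_right _ measurable_const, setLIntegral_const, volume_cell_eq_esize,
          mul_add, mul_left_comm, hone, mul_one, cellAvg]

theorem descSum_children_eq (μ : Measure E3) (h : ℕ → E3 → ℝ≥0∞) (n k : ℕ) (i : Fin 3 → ℤ) :
    descSum children (fun k i => ∫⁻ x in cell k i, h k x ∂μ) n k i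
      = ∑ l ∈ Finset.range n, ∫⁻ x in cell k i, h (l + k) x ∂μ := by
  induction n generalizing k i with
  | zero => simp [descSum]
  | succ n ih =>
    rw [descSum, Finset.sum_range_succ', zero_add, add_comm]
    congr 1
    simp_rw [ih]
    rw [Finset.sum_comm]
    refine Finset.sum_congr rfl fun l _ => ?_
    rw [lintegral_cell_eq_sum_children μ _ k i, show l + (k + 1) = l + 1 + k by ring]

theorem coe_descSum {ι : Type*} (ch : ι → Finset ι) (φ : ℕ → ι → ℝ≥0) (n k : ℕ) (i : ι) :
    ((descSum ch φ n k i : ℝ≥0) : ℝ≥0∞) = descSum ch (fun k i => (φ k i : ℝ≥0∞)) n k i := by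
  induction n generalizing k i with
  | zero => simp [descSum]
  | succ n ih => simp [descSum, ih]

theorem sum_range_inv_esize_le (k n : ℕ) :
    ∑ l ∈ Finset.range n, (esize (l + k))⁻¹ ≤ (esize (n + k))⁻¹ := by
  induction n with
  | zero => simp
  | succ n ih =>
    rw [Finset.sum_range_succ, show n + 1 + k = n + k + 1 by ring, inv_esize_succ, two_mul]
    exact add_le_add ih le_rfl

theorem sum_range_indicator_cell_le (k n : ℕ) (x y : E3) :
    ∑ l ∈ Finset.range n,
      (esize (l + k))⁻¹ * (cell (l + k) (addr (l + k) x)).indicator 1 y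
        ≤ 4 * (edist x y)⁻¹ := by
  induction n with
  | zero => simp
  | succ n ih =>
    by_cases hy : y ∈ cell (n + k) (addr (n + k) x)
    · calc _ ≤ ∑ l ∈ Finset.range (n + 1), (esize (l + k))⁻¹ := by
            refine Finset.sum_le_sum fun l _ => ?_
            refine mul_le_of_le_one_right zero_le ?_
            exact Set.indicator_le_self' (fun _ _ => zero_le) y
        _ ≤ 4 * (2 * esize (n + k))⁻¹ := by
            refine (sum_range_inv_esize_le k (n + 1)).trans (le_of_eq ?_)
            rw [show n + 1 + k = n + k + 1 by ring, inv_esize_succ,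
              ENNReal.mul_inv (by simp) (by simp), ← mul_assoc]
            congr 1
            rw [show (4 : ℝ≥0∞) = 2 * 2 by norm_num, mul_assoc,
              ENNReal.mul_inv_cancel two_ne_zero ofNat_ne_top, mul_one]
        _ ≤ _ := by
            gcongr
            have := edist_le_of_mem_cell (mem_cell_addr (n + k) x) hy
            rwa [ENNReal.ofReal_mul two_pos.le, ENNReal.ofReal_ofNat] at this
    · rw [Finset.sum_range_succ, Set.indicator_of_notMem hy, mul_zero, add_zero]
      exact ih

/-- The Kerman–Sawyer testing condition implies the dyadic Carleson packing condition. -/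
theorem sum_range_lintegral_cell_measure_le {μ : Measure E3} {A : ℝ≥0∞} {k : ℕ} {i : Fin 3 → ℤ}
    (htest : ∫⁻ x in cell k i, ∫⁻ y in cell k i, (edist x y)⁻¹ ∂μ ∂μ ≤ A * μ (cell k i)) (n : ℕ) :
    ∑ l ∈ Finset.range n,
        ∫⁻ x in cell k i, (esize (l + k))⁻¹ * μ (cell (l + k) (addr (l + k) x)) ∂μ
      ≤ 4 * (A * μ (cell k i)) := by
  rw [← lintegral_finsetSum _ fun l _ =>
    (measurable_addr_comp (fun m => μ (cell (l + k) m)) (l + k)).const_mul _]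
  refine le_trans ?_ (mul_le_mul' le_rfl htest)
  rw [← lintegral_const_mul' _ _ ofNat_ne_top]
  refine setLIntegral_mono' (measurableSet_cell k i) fun x hx => ?_
  rw [← lintegral_const_mul' _ _ ofNat_ne_top]
  refine le_trans (le_of_eq ?_) (lintegral_mono fun y => sum_range_indicator_cell_le k n x y)
  rw [lintegral_finsetSum _ fun l _ =>
    (measurable_one.indicator (measurableSet_cell _ _)).const_mul _]
  refine Finset.sum_congr rfl fun l _ => ?_
  rw [lintegral_const_mul _ (measurable_one.indicator (measurableSet_cell _ _)),
    lintegral_indicator_one (measurableSet_cell _ _),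
    Measure.restrict_apply (measurableSet_cell _ _), Set.inter_eq_left.mpr]
  rw [← mem_cell.mp hx]
  exact cell_addr_subset (Nat.le_add_left k l) x

theorem sq_lintegral_le {α : Type*} [MeasurableSpace α] (μ : Measure α) {g : α → ℝ≥0∞}
    (hg : Measurable g) :
    (∫⁻ x, g x ∂μ) ^ 2 ≤ μ Set.univ * ∫⁻ x, g x ^ 2 ∂μ := by
  have h := ENNReal.lintegral_mul_le_Lp_mul_Lq μ Real.HolderConjugate.two_two
    (f := fun _ => 1) (g := g) aemeasurable_const hg.aemeasurable
  simp only [Pi.mul_apply, one_mul, one_pow, lintegral_one, ENNReal.rpow_two] at h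
  calc (∫⁻ x, g x ∂μ) ^ 2
      ≤ (μ Set.univ ^ (1 / 2 : ℝ) * (∫⁻ x, g x ^ 2 ∂μ) ^ (1 / 2 : ℝ)) ^ 2 := by gcongr
    _ = _ := by
      rw [mul_pow, ← ENNReal.rpow_natCast, ← ENNReal.rpow_mul, ← ENNReal.rpow_natCast,
        ← ENNReal.rpow_mul]
      norm_num

/-- The dyadic Carleson embedding for a measure satisfying the Kerman–Sawyer testing condition. -/
theorem tsum_lintegral_mul_lintegral_cell_le {μ : Measure E3} {ε : ℝ≥0} (hε : 0 < ε)
    (hfin : ∀ k i, μ (cell k i) ≠ ∞)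
    (htest : ∀ k i, ∫⁻ x in cell k i, ∫⁻ y in cell k i, (edist x y)⁻¹ ∂μ ∂μ ≤ ε * μ (cell k i))
    {g : E3 → ℝ≥0∞} (hg : Measurable g) (hg2 : ∫⁻ x, g x ^ 2 ∂μ ≠ ∞) :
    ∑' k, (esize k)⁻¹ * ∫⁻ x, g x * ∫⁻ y in cell k (addr k x), g y ∂μ ∂μ
      ≤ 16 * ε * ∫⁻ x, g x ^ 2 ∂μ := by
  have hF : ∀ k i, ∫⁻ x in cell k i, g x ^ 2 ∂μ ≠ ∞ := fun k i =>
    ne_top_of_le_ne_top hg2 (setLIntegral_le_lintegral _ _)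
  have hGF : ∀ k i, (∫⁻ x in cell k i, g x ∂μ) ^ 2
      ≤ μ (cell k i) * ∫⁻ x in cell k i, g x ^ 2 ∂μ := fun k i => by
    have := sq_lintegral_le (μ.restrict (cell k i)) hg
    rwa [Measure.restrict_apply_univ] at this
  have hG : ∀ k i, ∫⁻ x in cell k i, g x ∂μ ≠ ∞ := fun k i h => by
    have := hGF k i
    rw [h] at this
    exact (ENNReal.mul_ne_top (hfin k i) (hF k i)) (top_le_iff.mp (by simpa using this))
  set A : ℝ≥0 := 4 * ε with hA
  have hA0 : (A : ℝ≥0∞) ≠ 0 := by simp [hA, hε.ne']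
  set b : ℕ → ℝ≥0 := fun k => (A * (side k).toNNReal)⁻¹ with hb
  have hbE : ∀ k, (b k : ℝ≥0∞) = (A : ℝ≥0∞)⁻¹ * (esize k)⁻¹ := fun k => by
    have h1 : A * (side k).toNNReal ≠ 0 :=
      mul_ne_zero (by exact_mod_cast hA0) (by simp [side_pos k])
    rw [hb, ENNReal.coe_inv h1, ENNReal.coe_mul,
      ENNReal.mul_inv (Or.inl hA0) (Or.inl ENNReal.coe_ne_top)]
    rfl
  have hm1 : ∀ k i, μ (cell k i) = ∫⁻ x in cell k i, 1 ∂μ := fun k i => by simp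
  have hcarl := carleson_embedding children (fun k i => (∫⁻ x in cell k i, g x ∂μ).toNNReal)
    (fun k i => (μ (cell k i)).toNNReal) (fun k i => (∫⁻ x in cell k i, g x ^ 2 ∂μ).toNNReal) b
    (fun k i => by
      rw [lintegral_cell_eq_sum_children, ENNReal.toNNReal_sum fun j _ => hG _ _])
    (fun k i => by
      rw [hm1, lintegral_cell_eq_sum_children, ENNReal.toNNReal_sum fun j _ => by
        rw [← hm1]; exact hfin _ _]
      simp_rw [← hm1])
    (fun k i => by
      rw [lintegral_cell_eq_sum_children, ENNReal.toNNReal_sum fun j _ => hF _ _])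
    (fun k i => by
      rw [← ENNReal.coe_le_coe]
      push_cast
      rw [ENNReal.coe_toNNReal (hG k i), ENNReal.coe_toNNReal (hfin k i),
        ENNReal.coe_toNNReal (hF k i)]
      exact hGF k i)
    (fun n k i => by
      rw [← ENNReal.coe_le_coe, coe_descSum]
      have : (fun k i => ((b k * (μ (cell k i)).toNNReal ^ 2 : ℝ≥0) : ℝ≥0∞))
          = fun k i => ∫⁻ x in cell k i, b k * μ (cell k (addr k x)) ∂μ := by
        funext k i
        rw [ENNReal.coe_mul, ENNReal.coe_pow, ENNReal.coe_toNNReal (hfin k i),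
          lintegral_cell_mul_addr μ measurable_const (fun m => μ (cell k m)), setLIntegral_const]
        ring
      rw [this, descSum_children_eq, ENNReal.coe_toNNReal (hfin k i)]
      simp_rw [hbE, mul_assoc]
      have hmeas : ∀ l, Measurable fun x =>
          (esize (l + k))⁻¹ * μ (cell (l + k) (addr (l + k) x)) := fun l =>
        (measurable_addr_comp (fun m => μ (cell (l + k) m)) (l + k)).const_mul _
      simp_rw [lintegral_const_mul _ (hmeas _)]
      rw [← Finset.mul_sum]
      refine (mul_le_mul' le_rfl (sum_range_lintegral_cell_measure_le (htest k i) n)).trans ?_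
      rw [← mul_assoc 4, ← mul_assoc, show (4 : ℝ≥0∞) * ε = A by simp [hA],
        ENNReal.inv_mul_cancel hA0 ENNReal.coe_ne_top, one_mul])
  have hGm : ∀ k, Measurable fun x => ∫⁻ y in cell k (addr k x), g y ∂μ := fun k =>
    measurable_addr_comp (fun m => ∫⁻ y in cell k m, g y ∂μ) k
  have hgGm : ∀ k, Measurable fun x => g x * ∫⁻ y in cell k (addr k x), g y ∂μ := fun k =>
    hg.mul (hGm k)
  have hcell : ∀ n i, ∑ l ∈ Finset.range n, (A : ℝ≥0∞)⁻¹ * ((esize l)⁻¹ *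
      ∫⁻ x in cell 0 i, g x * ∫⁻ y in cell l (addr l x), g y ∂μ ∂μ)
        ≤ 4 * ∫⁻ x in cell 0 i, g x ^ 2 ∂μ := fun n i => by
    have h := hcarl n 0 i
    rw [← ENNReal.coe_le_coe, coe_descSum, ENNReal.coe_mul, ENNReal.coe_toNNReal (hF 0 i)] at h
    have : (fun k i => ((b k * (∫⁻ x in cell k i, g x ∂μ).toNNReal ^ 2 : ℝ≥0) : ℝ≥0∞))
        = fun k i => ∫⁻ x in cell k i,
          b k * (g x * ∫⁻ y in cell k (addr k x), g y ∂μ) ∂μ := by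
      funext k i
      rw [lintegral_const_mul _ (hgGm k), ENNReal.coe_mul, ENNReal.coe_pow,
        ENNReal.coe_toNNReal (hG k i),
        lintegral_cell_mul_addr μ hg (fun m => ∫⁻ y in cell k m, g y ∂μ), sq]
    rw [this, descSum_children_eq] at h
    simp_rw [add_zero, lintegral_const_mul _ (hgGm _), hbE, mul_assoc] at h
    exact h
  have hsum : ∀ n, ∑ l ∈ Finset.range n, (A : ℝ≥0∞)⁻¹ * ((esize l)⁻¹ *
      ∫⁻ x, g x * ∫⁻ y in cell l (addr l x), g y ∂μ ∂μ) ≤ 4 * ∫⁻ x, g x ^ 2 ∂μ := fun n => by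
    simp_rw [lintegral_eq_tsum_cell μ _ 0, ← ENNReal.tsum_mul_left]
    rw [← Summable.tsum_finsetSum fun _ _ => ENNReal.summable]
    exact ENNReal.tsum_le_tsum fun i => hcell n i
  have htot := ENNReal.tsum_le_of_sum_range_le hsum
  rw [ENNReal.tsum_mul_left] at htot
  have := mul_le_mul' (le_refl (A : ℝ≥0∞)) htot
  rw [← mul_assoc, ENNReal.mul_inv_cancel hA0 ENNReal.coe_ne_top, one_mul] at this
  refine this.trans (le_of_eq ?_)
  rw [hA]
  push_cast
  ring

theorem sq_tsum_le (u : ℕ → ℝ≥0∞) : (∑' k, u k) ^ 2 ≤ 2 * ∑' k, ∑' j, u k * u (j + k) := by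
  have hT : ∀ k, ∑' l, (if k ≤ l then u k * u l else 0) = ∑' j, u k * u (j + k) := fun k => by
    rw [← Summable.sum_add_tsum_nat_add' (f := fun l => if k ≤ l then u k * u l else 0) (k := k)
      ENNReal.summable, Finset.sum_eq_zero, zero_add]
    · simp
    · intro l hl
      rw [if_neg (not_le.mpr (Finset.mem_range.mp hl))]
  calc (∑' k, u k) ^ 2 = ∑' k, ∑' l, u k * u l := by
        simp_rw [sq, ENNReal.tsum_mul_left, ENNReal.tsum_mul_right]
    _ ≤ ∑' k, ∑' l, ((if k ≤ l then u k * u l else 0) + if l ≤ k then u l * u k else 0) := by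
        refine ENNReal.tsum_le_tsum fun k => ENNReal.tsum_le_tsum fun l => ?_
        rcases le_total k l with h | h
        · simp [h]
        · simp [h, mul_comm]
    _ = _ := by
        simp_rw [ENNReal.tsum_add]
        rw [two_mul]
        congr 1
        · exact tsum_congr hT
        · rw [ENNReal.tsum_comm]
          exact tsum_congr hT

/-- The dyadic fractional integral of order one of the measure `g μ`. -/
def dyadicI1 (μ : Measure E3) (g : E3 → ℝ≥0∞) (y : E3) : ℝ≥0∞ :=
  ∑' k, (esize k)⁻¹ ^ 2 * ∫⁻ x in cell k (addr k y), g x ∂μ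

theorem measurable_lintegral_cell (μ : Measure E3) (g : E3 → ℝ≥0∞) (k : ℕ) :
    Measurable fun x => ∫⁻ y in cell k (addr k x), g y ∂μ :=
  measurable_addr_comp (fun m => ∫⁻ y in cell k m, g y ∂μ) k

theorem lintegral_cell_mul_cell (μ : Measure E3) {g : E3 → ℝ≥0∞} (hg : Measurable g) {k l : ℕ}
    (hkl : k ≤ l) :
    ∫⁻ y, (∫⁻ x in cell k (addr k y), g x ∂μ) * ∫⁻ x in cell l (addr l y), g x ∂μ
      = esize l ^ 3 * ∫⁻ x, g x * ∫⁻ y in cell k (addr k x), g y ∂μ ∂μ := by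
  rw [lintegral_mul_lintegral_cell_comm volume μ (measurable_lintegral_cell μ g k) hg,
    ← lintegral_const_mul _ (hg.fun_mul (measurable_lintegral_cell μ g k))]
  refine lintegral_congr fun x => ?_
  rw [setLIntegral_congr_fun (g := fun _ => ∫⁻ y in cell k (addr k x), g y ∂μ)
    (measurableSet_cell _ _) fun y hy => by simp only [addr_eq_of_le hkl (mem_cell.mp hy)],
    setLIntegral_const, volume_cell_eq_esize]
  ring

theorem lintegral_dyadicI1_sq_le (μ : Measure E3) {g : E3 → ℝ≥0∞} (hg : Measurable g) :
    ∫⁻ y, dyadicI1 μ g y ^ 2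
      ≤ 4 * ∑' k, (esize k)⁻¹ * ∫⁻ x, g x * ∫⁻ y in cell k (addr k x), g y ∂μ ∂μ := by
  set S : ℕ → ℝ≥0∞ := fun k => ∫⁻ x, g x * ∫⁻ y in cell k (addr k x), g y ∂μ ∂μ
  have hm : ∀ k, Measurable fun y => (esize k)⁻¹ ^ 2 * ∫⁻ x in cell k (addr k y), g x ∂μ :=
    fun k => (measurable_lintegral_cell μ g k).const_mul _
  have hterm : ∀ k j, ∫⁻ y, ((esize k)⁻¹ ^ 2 * ∫⁻ x in cell k (addr k y), g x ∂μ) *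
      ((esize (j + k))⁻¹ ^ 2 * ∫⁻ x in cell (j + k) (addr (j + k) y), g x ∂μ)
        = (esize k)⁻¹ * S k * 2⁻¹ ^ j := fun k j => by
    have hfin : (esize k)⁻¹ ^ 2 * (esize (j + k))⁻¹ ^ 2 ≠ ∞ := by
      refine ENNReal.mul_ne_top (ENNReal.pow_ne_top ?_) (ENNReal.pow_ne_top ?_) <;>
      exact ENNReal.inv_ne_top.mpr (esize_ne_zero _)
    simp_rw [mul_mul_mul_comm]
    rw [lintegral_const_mul' _ _ hfin, lintegral_cell_mul_cell μ hg (Nat.le_add_left k j)]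
    have h1 := inv_esize_mul k
    have h2 := inv_esize_mul (j + k)
    have h3 := esize_add k j
    change _ * (_ * S k) = _
    generalize (esize (j + k))⁻¹ = b at *
    generalize esize (j + k) = b' at *
    generalize (esize k)⁻¹ = a at *
    generalize esize k = a' at *
    calc a ^ 2 * b ^ 2 * (b' ^ 3 * S k) = a ^ 2 * (b * b') ^ 2 * b' * S k := by ring
      _ = a * (a * a') * S k * 2⁻¹ ^ j := by rw [h2, h3]; ring
      _ = _ := by rw [h1, mul_one]
  calc ∫⁻ y, dyadicI1 μ g y ^ 2
      ≤ ∫⁻ y, 2 * ∑' k, ∑' j, ((esize k)⁻¹ ^ 2 * ∫⁻ x in cell k (addr k y), g x ∂μ) *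
        ((esize (j + k))⁻¹ ^ 2 * ∫⁻ x in cell (j + k) (addr (j + k) y), g x ∂μ) :=
        lintegral_mono fun y => sq_tsum_le _
    _ = 2 * ∑' k, ∑' j, (esize k)⁻¹ * S k * 2⁻¹ ^ j := by
        rw [lintegral_const_mul' _ _ ofNat_ne_top, lintegral_tsum fun k =>
          (Measurable.tsum fun j => (hm k).fun_mul (hm (j + k))).aemeasurable]
        congr 1
        refine tsum_congr fun k => ?_
        rw [lintegral_tsum fun j => ((hm k).fun_mul (hm (j + k))).aemeasurable]
        exact tsum_congr fun j => hterm k j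
    _ = 4 * ∑' k, (esize k)⁻¹ * S k := by
        simp_rw [ENNReal.tsum_mul_left, ENNReal.tsum_geometric, ENNReal.one_sub_inv_two, inv_inv,
          ENNReal.tsum_mul_right]
        ring

theorem ennreal_young {a b : ℝ≥0∞} {ε : ℝ≥0} (hε : 0 < ε) :
    128 * (a * b) ≤ 2 ^ 20 * ε * a ^ 2 + (256 * ε : ℝ≥0∞)⁻¹ * b ^ 2 := by
  rcases eq_or_ne a ∞ with rfl | ha
  · have : (2 ^ 20 * ε * ∞ ^ 2 : ℝ≥0∞) = ∞ := by
      rw [ENNReal.top_pow two_ne_zero, ENNReal.mul_top (by simp [hε.ne'])]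
    rw [this]
    simp
  rcases eq_or_ne b ∞ with rfl | hb
  · have : ((256 * ε : ℝ≥0∞)⁻¹ * ∞ ^ 2 : ℝ≥0∞) = ∞ := by
      rw [ENNReal.top_pow two_ne_zero, ENNReal.mul_top]
      exact ENNReal.inv_ne_zero.mpr (ENNReal.mul_ne_top ofNat_ne_top ENNReal.coe_ne_top)
    rw [this]
    simp
  lift a to ℝ≥0 using ha
  lift b to ℝ≥0 using hb
  have h : 128 * (a * b) ≤ 2 ^ 20 * ε * a ^ 2 + (256 * ε)⁻¹ * b ^ 2 := by
    rw [← NNReal.coe_le_coe]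
    push_cast
    have he : (0 : ℝ) < ε := hε
    have : (0 : ℝ) ≤ (256 * ε : ℝ)⁻¹ * (2 ^ 14 * ε * a - b) ^ 2 := by positivity
    have h2 : (256 * ε : ℝ)⁻¹ * (2 ^ 14 * ε * a - b) ^ 2
        = 2 ^ 20 * ε * a ^ 2 + (256 * ε : ℝ)⁻¹ * b ^ 2 - 128 * (a * b) := by
      field_simp
      ring
    linarith
  have h' := ENNReal.coe_le_coe.mpr h
  rw [ENNReal.coe_add, ENNReal.coe_mul _ (b ^ 2), ENNReal.coe_inv (by positivity)] at h'
  push_cast at h'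
  exact h'

theorem ennreal_mul_le_sq_add_sq (a b : ℝ≥0∞) : a * b ≤ 4⁻¹ * a ^ 2 + b ^ 2 := by
  rcases eq_or_ne a ∞ with rfl | ha
  · simp
  rcases eq_or_ne b ∞ with rfl | hb
  · simp
  lift a to ℝ≥0 using ha
  lift b to ℝ≥0 using hb
  have h : a * b ≤ 4⁻¹ * a ^ 2 + b ^ 2 := by
    rw [← NNReal.coe_le_coe]
    push_cast
    nlinarith [sq_nonneg ((a : ℝ) / 2 - b)]
  have h' := ENNReal.coe_le_coe.mpr h
  rw [ENNReal.coe_add, ENNReal.coe_mul _ (a ^ 2), ENNReal.coe_inv (by positivity)] at h'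
  push_cast at h'
  exact h'

/-- The trace inequality, with a lower order term, for measures satisfying the Kerman–Sawyer
testing condition on the dyadic cells. -/
theorem trace_inequality {μ : Measure E3} {ε M : ℝ≥0} (hε : 0 < ε)
    (hM : ∀ i, μ (cell 0 i) ≤ M)
    (htest : ∀ k i, ∫⁻ x in cell k i, ∫⁻ y in cell k i, (edist x y)⁻¹ ∂μ ∂μ ≤ ε * μ (cell k i))
    {ψ : E3 → ℂ} (hψ : ContDiff ℝ 1 ψ) (hfin : ∫⁻ x, ‖ψ x‖ₑ ^ 2 ∂μ ≠ ∞) :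
    ∫⁻ x, ‖ψ x‖ₑ ^ 2 ∂μ ≤ 2 ^ 21 * ε * (∫⁻ x, ‖fderiv ℝ ψ x‖ₑ ^ 2)
      + 2 * (esize 0)⁻¹ ^ 3 * M * ∫⁻ x, ‖ψ x‖ₑ ^ 2 := by
  have hg : Measurable fun x => ‖ψ x‖ₑ := hψ.continuous.enorm.measurable
  have hf : Measurable fun x => ‖fderiv ℝ ψ x‖ₑ :=
    (hψ.continuous_fderiv one_ne_zero).enorm.measurable
  set X := ∫⁻ x, ‖ψ x‖ₑ ^ 2 ∂μ with hX
  have hcellfin : ∀ k i, μ (cell k i) ≠ ∞ := fun k i => by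
    rcases (cell k i).eq_empty_or_nonempty with h | ⟨x, hx⟩
    · simp [h]
    · refine ne_top_of_le_ne_top ENNReal.coe_ne_top (le_trans (measure_mono ?_) (hM (addr 0 x)))
      rw [← mem_cell.mp hx]
      exact cell_addr_subset (Nat.zero_le k) x
  have hone : (esize 0)⁻¹ ^ 3 * esize 0 ^ 3 = 1 := by rw [← mul_pow, inv_esize_mul, one_pow]
  have hI : ∫⁻ y, dyadicI1 μ (fun x => ‖ψ x‖ₑ) y ^ 2 ≤ 64 * ε * X := by
    refine (lintegral_dyadicI1_sq_le μ hg).trans ?_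
    refine (mul_le_mul' le_rfl
      (tsum_lintegral_mul_lintegral_cell_le hε hcellfin htest hg hfin)).trans (le_of_eq ?_)
    ring
  have hIm : Measurable (dyadicI1 μ fun x => ‖ψ x‖ₑ) :=
    Measurable.tsum fun k => (measurable_lintegral_cell μ _ k).const_mul _
  have hlow : ∫⁻ x, ‖ψ x‖ₑ * cellAvg ψ 0 x ∂μ
      ≤ 4⁻¹ * X + (esize 0)⁻¹ ^ 3 * M * ∫⁻ x, ‖ψ x‖ₑ ^ 2 := by
    calc ∫⁻ x, ‖ψ x‖ₑ * cellAvg ψ 0 x ∂μ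
        ≤ ∫⁻ x, (4⁻¹ * ‖ψ x‖ₑ ^ 2
          + (esize 0)⁻¹ ^ 3 * ∫⁻ y in cell 0 (addr 0 x), ‖ψ y‖ₑ ^ 2) ∂μ := by
          refine lintegral_mono fun x => ?_
          rw [cellAvg, mul_left_comm, ← lintegral_const_mul _ hg]
          calc _ ≤ (esize 0)⁻¹ ^ 3 *
                ∫⁻ y in cell 0 (addr 0 x), (4⁻¹ * ‖ψ x‖ₑ ^ 2 + ‖ψ y‖ₑ ^ 2) :=
                mul_le_mul' le_rfl (lintegral_mono fun y => ennreal_mul_le_sq_add_sq _ _)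
            _ = _ := by
                rw [lintegral_add_left measurable_const, setLIntegral_const,
                  volume_cell_eq_esize, mul_add, mul_left_comm, hone, mul_one]
      _ = 4⁻¹ * X + (esize 0)⁻¹ ^ 3 * ∫⁻ y, ‖ψ y‖ₑ ^ 2 * μ (cell 0 (addr 0 y)) := by
          rw [lintegral_add_left ((hg.pow_const 2).const_mul _),
            lintegral_const_mul _ (hg.pow_const 2),
            lintegral_const_mul _ (measurable_lintegral_cell volume _ 0)]
          have := lintegral_mul_lintegral_cell_comm μ volume (f := fun _ => 1)
            measurable_const (hg.pow_const 2) 0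
          simp only [one_mul, setLIntegral_one] at this
          rw [this]
      _ ≤ _ := by
          rw [mul_assoc _ (M : ℝ≥0∞)]
          refine add_le_add le_rfl (mul_le_mul' le_rfl ?_)
          rw [← lintegral_const_mul _ (hg.pow_const 2)]
          refine lintegral_mono fun y => ?_
          exact (mul_le_mul' le_rfl (hM _)).trans_eq (mul_comm _ _)
  have hhigh : ∫⁻ x, ‖ψ x‖ₑ * (128 * ∑' k, (esize k)⁻¹ ^ 2 *
      ∫⁻ y in cell k (addr k x), ‖fderiv ℝ ψ y‖ₑ) ∂μ
        ≤ 2 ^ 20 * ε * (∫⁻ x, ‖fderiv ℝ ψ x‖ₑ ^ 2) + 4⁻¹ * X := by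
    calc _ = 128 * ∫⁻ y, ‖fderiv ℝ ψ y‖ₑ * dyadicI1 μ (fun x => ‖ψ x‖ₑ) y := by
          simp_rw [mul_left_comm _ (128 : ℝ≥0∞)]
          rw [lintegral_const_mul' _ _ ofNat_ne_top]
          congr 1
          simp_rw [dyadicI1, ← ENNReal.tsum_mul_left]
          rw [lintegral_tsum fun k => (hg.fun_mul
            ((measurable_lintegral_cell volume _ k).const_mul _)).aemeasurable,
            lintegral_tsum fun k => (hf.fun_mul
            ((measurable_lintegral_cell μ _ k).const_mul _)).aemeasurable]
          refine tsum_congr fun k => ?_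
          have hne : (esize k)⁻¹ ^ 2 ≠ ∞ :=
            ENNReal.pow_ne_top (ENNReal.inv_ne_top.mpr (esize_ne_zero _))
          simp_rw [mul_left_comm _ ((esize k)⁻¹ ^ 2)]
          rw [lintegral_const_mul' _ _ hne, lintegral_const_mul' _ _ hne,
            lintegral_mul_lintegral_cell_comm μ volume hg hf]
      _ ≤ ∫⁻ y, (2 ^ 20 * ε * ‖fderiv ℝ ψ y‖ₑ ^ 2
          + (256 * ε : ℝ≥0∞)⁻¹ * dyadicI1 μ (fun x => ‖ψ x‖ₑ) y ^ 2) := by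
          rw [← lintegral_const_mul' _ _ ofNat_ne_top]
          exact lintegral_mono fun y => ennreal_young hε
      _ = 2 ^ 20 * ε * (∫⁻ y, ‖fderiv ℝ ψ y‖ₑ ^ 2)
          + (256 * ε : ℝ≥0∞)⁻¹ * ∫⁻ y, dyadicI1 μ (fun x => ‖ψ x‖ₑ) y ^ 2 := by
          rw [lintegral_add_left ((hf.pow_const 2).const_mul _),
            lintegral_const_mul _ (hf.pow_const 2), lintegral_const_mul _ (hIm.pow_const 2)]
      _ ≤ 2 ^ 20 * ε * (∫⁻ y, ‖fderiv ℝ ψ y‖ₑ ^ 2)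
          + (256 * ε : ℝ≥0∞)⁻¹ * (64 * ε * X) := by gcongr
      _ = _ := by
          congr 1
          have he : (64 * ε : ℝ≥0∞) ≠ 0 := by simp [hε.ne']
          have he' : (64 * ε : ℝ≥0∞) ≠ ∞ := ENNReal.mul_ne_top ofNat_ne_top ENNReal.coe_ne_top
          rw [show (256 * ε : ℝ≥0∞) = 4 * (64 * ε) by ring,
            ENNReal.mul_inv (by simp) (by simp), ← mul_assoc, mul_assoc (4⁻¹ : ℝ≥0∞),
            ENNReal.inv_mul_cancel he he', mul_one]
  have htot : X ≤ 4⁻¹ * X + (esize 0)⁻¹ ^ 3 * M * (∫⁻ x, ‖ψ x‖ₑ ^ 2)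
      + (2 ^ 20 * ε * (∫⁻ x, ‖fderiv ℝ ψ x‖ₑ ^ 2) + 4⁻¹ * X) := by
    refine le_trans ?_ (add_le_add hlow hhigh)
    have hA : Measurable fun x => ‖ψ x‖ₑ * cellAvg ψ 0 x :=
      hg.mul ((measurable_lintegral_cell volume _ 0).const_mul _)
    rw [← lintegral_add_left hA]
    refine lintegral_mono fun x => ?_
    rw [sq, ← mul_add]
    exact mul_le_mul' le_rfl (enorm_le_cellAvg_add_tsum hψ x)
  set a := (esize 0)⁻¹ ^ 3 * M * (∫⁻ x, ‖ψ x‖ₑ ^ 2)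
  set b := 2 ^ 20 * ε * (∫⁻ x, ‖fderiv ℝ ψ x‖ₑ ^ 2)
  have hhalf : (4⁻¹ : ℝ≥0∞) * X + 4⁻¹ * X = 2⁻¹ * X := by
    rw [← two_mul, ← mul_assoc, show (4 : ℝ≥0∞) = 2 * 2 by norm_num,
      ENNReal.mul_inv (by simp) (by simp), ← mul_assoc,
      ENNReal.mul_inv_cancel two_ne_zero ofNat_ne_top, one_mul]
  have hX2 : X = 2⁻¹ * X + 2⁻¹ * X := by
    rw [← add_mul, ENNReal.inv_two_add_inv_two, one_mul]
  have hcancel : 2⁻¹ * X ≤ a + b := by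
    have hne : 2⁻¹ * X ≠ ∞ := ENNReal.mul_ne_top (by simp) hfin
    refine (ENNReal.add_le_add_iff_left hne).mp ?_
    calc 2⁻¹ * X + 2⁻¹ * X = X := hX2.symm
      _ ≤ _ := htot
      _ = (4⁻¹ * X + 4⁻¹ * X) + (a + b) := by ring
      _ = _ := by rw [hhalf]
  calc X = 2 * (2⁻¹ * X) := by
        rw [← mul_assoc, ENNReal.mul_inv_cancel two_ne_zero ofNat_ne_top, one_mul]
    _ ≤ 2 * (a + b) := by gcongr
    _ = _ := by simp only [a, b]; ring

/-- The vector `2πn` of the lattice `(2πℤ)³`. -/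
def latticeVec (n : Fin 3 → ℤ) : E3 := (WithLp.equiv 2 (Fin 3 → ℝ)).symm fun i => 2 * π * n i

theorem addr_add_latticeVec (k : ℕ) (x : E3) (n : Fin 3 → ℤ) :
    addr k (x + latticeVec n) = addr k x + 2 ^ k • n := by
  funext i
  have h : (x + latticeVec n) i / side k = x i / side k + ((2 ^ k * n i : ℤ) : ℝ) := by
    have : (x + latticeVec n) i = x i + 2 * π * n i := rfl
    rw [this, add_div, side]
    push_cast
    field_simp
  simp only [addr, h, Int.floor_add_intCast, Pi.add_apply, nsmul_eq_mul]
  push_cast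
  rfl

theorem lintegral_cell_add_latticeVec (F : E3 → ℝ≥0∞) (k : ℕ) (m n : Fin 3 → ℤ) :
    ∫⁻ x in cell k (m + 2 ^ k • n), F x = ∫⁻ x in cell k m, F (x + latticeVec n) := by
  rw [← lintegral_indicator (measurableSet_cell _ _), ← lintegral_indicator (measurableSet_cell _ _),
    ← lintegral_add_right_eq_self _ (latticeVec n)]
  refine lintegral_congr fun x => ?_
  simp only [Set.indicator_apply, mem_cell, addr_add_latticeVec]
  exact if_congr (add_left_inj (2 ^ k • n)) rfl rfl

theorem exists_add_smul_eq (k : ℕ) (m : Fin 3 → ℤ) :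
    ∃ m' n : Fin 3 → ℤ, m' + 2 ^ k • n = m ∧ cell k m' ⊆ Ω3 := by
  refine ⟨fun i => m i % 2 ^ k, fun i => m i / 2 ^ k, ?_, fun x hx i => ?_⟩
  · funext i
    simpa using Int.emod_add_mul_ediv (m i) (2 ^ k)
  · have hk : (0 : ℤ) < 2 ^ k := by positivity
    have h := mem_cell_iff.mp hx i
    have h0 : (0 : ℝ) ≤ ((m i % 2 ^ k : ℤ) : ℝ) := by exact_mod_cast Int.emod_nonneg _ hk.ne'
    have h1 : ((m i % 2 ^ k : ℤ) : ℝ) + 1 ≤ 2 ^ k := by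
      exact_mod_cast Int.emod_lt_of_pos (m i) hk
    refine ⟨(mul_nonneg h0 (side_pos k).le).trans h.1, h.2.trans_le ?_⟩
    calc _ ≤ 2 ^ k * side k := mul_le_mul_of_nonneg_right h1 (side_pos k).le
      _ = 2 * π := by unfold side; field_simp

/-- The Kerman–Sawyer testing condition on a cube. -/
theorem lintegral_cube3_le_of_ksNorm_le {u : E3 → ℝ≥0∞} {ε : ℝ≥0} (h : ksNorm u ≤ ε) (z : E3)
    {r : ℝ} (hr : 0 < r) (hfin : ∫⁻ x in cube3 z r, u x ≠ ∞) :
    ∫⁻ x in cube3 z r, ∫⁻ y in cube3 z r, u x * u y / edist x y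
      ≤ ε * ∫⁻ x in cube3 z r, u x := by
  have hle : ksRatio u z r ≤ ε := by
    refine le_trans ?_ h
    unfold ksNorm
    exact le_iSup_of_le z (le_iSup_of_le r (le_iSup_of_le hr le_rfl))
  unfold ksRatio at hle
  rcases eq_or_ne (∫⁻ x in cube3 z r, u x) 0 with h0 | h0
  · rw [h0, ENNReal.inv_zero] at hle
    by_contra hne
    rw [ENNReal.top_mul (ne_bot_of_gt (not_le.mp hne))] at hle
    exact ENNReal.coe_ne_top (top_le_iff.mp hle)
  · rwa [ENNReal.inv_mul_le_iff h0 hfin, mul_comm] at hle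

theorem lintegral_cell_le_of_ksNorm_le {w u : E3 → ℝ≥0∞} {ε : ℝ≥0} (hw : Periodic3 w)
    (hu : Set.EqOn u w Ω3) (h : ksNorm u ≤ ε) (hfin : ∫⁻ x in Ω3, w x ≠ ∞) (k : ℕ)
    (m : Fin 3 → ℤ) :
    ∫⁻ x in cell k m, ∫⁻ y in cell k m, w x * w y / edist x y ≤ ε * ∫⁻ x in cell k m, w x := by
  obtain ⟨m, n, rfl, hm⟩ := exists_add_smul_eq k m
  have hw' : ∀ x, w (x + latticeVec n) = w x := fun x => hw x n
  simp_rw [lintegral_cell_add_latticeVec, hw', edist_add_right]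
  have hcongr : ∀ x ∈ cell k m, w x = u x := fun x hx => (hu (hm hx)).symm
  have hA : ∫⁻ x in cell k m, w x = ∫⁻ x in cube3 (center k m) (side k), u x := by
    rw [setLIntegral_congr_fun (measurableSet_cell k m) hcongr,
      Measure.restrict_congr_set (cell_ae_eq_cube3 k m)]
  have hI : ∫⁻ x in cell k m, ∫⁻ y in cell k m, w x * w y / edist x y
      = ∫⁻ x in cube3 (center k m) (side k), ∫⁻ y in cube3 (center k m) (side k),
        u x * u y / edist x y := by
    rw [← Measure.restrict_congr_set (cell_ae_eq_cube3 k m)]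
    refine setLIntegral_congr_fun (measurableSet_cell k m) fun x hx =>
      setLIntegral_congr_fun (measurableSet_cell k m) fun y hy => ?_
    simp only [hcongr x hx, hcongr y hy]
  rw [hA, hI]
  refine lintegral_cube3_le_of_ksNorm_le h _ (side_pos k) ?_
  rw [← hA]
  exact ne_top_of_le_ne_top hfin (lintegral_mono_set hm)

theorem lintegral_cell_zero_eq {w : E3 → ℝ≥0∞} (hw : Periodic3 w) (m : Fin 3 → ℤ) :
    ∫⁻ x in cell 0 m, w x = ∫⁻ x in Ω3, w x := by
  have h : m = 0 + 2 ^ 0 • m := by simp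
  rw [h, lintegral_cell_add_latticeVec, Ω3_eq_cell]
  exact lintegral_congr fun x => hw x m

theorem lintegral_lintegral_inv_edist_withDensity {w : E3 → ℝ≥0∞} (hw : AEMeasurable w volume)
    (hfin : ∀ x, w x ≠ ∞) {s : Set E3} (hs : MeasurableSet s) :
    ∫⁻ x in s, ∫⁻ y in s, (edist x y)⁻¹ ∂volume.withDensity w ∂volume.withDensity w
      = ∫⁻ x in s, ∫⁻ y in s, w x * w y / edist x y := by
  have hlt : ∀ᵐ x ∂volume.restrict s, w x < ∞ := ae_of_all _ fun x => (hfin x).lt_top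
  rw [setLIntegral_withDensity_eq_setLIntegral_mul_non_measurable₀ _ hw.restrict _ hs hlt]
  refine lintegral_congr fun x => ?_
  rw [Pi.mul_apply,
    setLIntegral_withDensity_eq_setLIntegral_mul_non_measurable₀ _ hw.restrict _ hs hlt,
    ← lintegral_const_mul' _ _ (hfin x)]
  refine lintegral_congr fun y => ?_
  rw [Pi.mul_apply, div_eq_mul_inv, mul_assoc]

/-- The trace inequality for the measure with density `w`. -/
theorem lintegral_sq_mul_le_of_ksNorm_le {w u : E3 → ℝ≥0∞} {ε : ℝ≥0} (hε : 0 < ε)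
    (hw : AEMeasurable w volume) (hw_fin : ∀ x, w x ≠ ∞) (hper : Periodic3 w)
    (hu : Set.EqOn u w Ω3) (h : ksNorm u ≤ ε) (hΩ : ∫⁻ x in Ω3, w x ≠ ∞) {ψ : E3 → ℂ}
    (hψ : ContDiff ℝ 1 ψ) (hfin : ∫⁻ x, ‖ψ x‖ₑ ^ 2 * w x ≠ ∞) :
    ∫⁻ x, ‖ψ x‖ₑ ^ 2 * w x ≤ 2 ^ 21 * ε * (∫⁻ x, ‖fderiv ℝ ψ x‖ₑ ^ 2)
      + 2 * (esize 0)⁻¹ ^ 3 * (∫⁻ x in Ω3, w x) * ∫⁻ x, ‖ψ x‖ₑ ^ 2 := by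
  have heq : ∫⁻ x, ‖ψ x‖ₑ ^ 2 ∂volume.withDensity w = ∫⁻ x, ‖ψ x‖ₑ ^ 2 * w x := by
    rw [lintegral_withDensity_eq_lintegral_mul_non_measurable₀ _ hw
      (ae_of_all _ fun x => (hw_fin x).lt_top)]
    exact lintegral_congr fun x => mul_comm _ _
  rw [← heq] at hfin ⊢
  rw [← ENNReal.coe_toNNReal hΩ]
  refine trace_inequality hε (fun i => ?_) (fun k i => ?_) hψ hfin
  · rw [withDensity_apply _ (measurableSet_cell _ _), lintegral_cell_zero_eq hper,
      ENNReal.coe_toNNReal hΩ]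
  · rw [lintegral_lintegral_inv_edist_withDensity hw hw_fin (measurableSet_cell _ _),
      withDensity_apply _ (measurableSet_cell _ _)]
    exact lintegral_cell_le_of_ksNorm_le hper hu h hΩ k i

theorem isBounded_Ω3 : Bornology.IsBounded Ω3 := by
  refine (Metric.isBounded_iff_subset_closedBall 0).mpr ⟨2 * side 0, fun x hx => ?_⟩
  have h0 : (0 : E3) ∈ Ω3 := fun i => ⟨le_rfl, by simpa using Real.pi_pos⟩
  rw [Ω3_eq_cell] at hx h0
  have h := edist_le_of_mem_cell hx h0
  rwa [edist_le_ofReal (by have := side_pos 0; positivity)] at h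

theorem lintegral_Ω3_enorm_ne_top {V : E3 → ℝ} (hV : LocallyIntegrable V volume) :
    ∫⁻ x in Ω3, ‖V x‖ₑ ≠ ∞ := by
  have h := (hV.integrableOn_isCompact isBounded_Ω3.isCompact_closure).mono_set subset_closure
  exact h.2.ne

theorem lintegral_sq_mul_enorm_ne_top {V : E3 → ℝ} (hV : LocallyIntegrable V volume)
    {ψ : E3 → ℂ} (hψ : Continuous ψ) (hsupp : HasCompactSupport ψ) :
    ∫⁻ x, ‖ψ x‖ₑ ^ 2 * ‖V x‖ₑ ≠ ∞ := by
  have hint : Integrable (fun x => ‖ψ x‖ ^ 2 • V x) volume :=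
    hV.integrable_smul_left_of_hasCompactSupport (by fun_prop)
      (hsupp.norm.comp_left (g := fun t : ℝ => t ^ 2) (by simp))
  have h := hint.2.ne
  simpa [enorm_mul, enorm_pow] using h

/-- Relative form bound for potentials satisfying the Kerman–Sawyer smallness condition. -/
theorem stmt5 :
    ∃ C : ℝ≥0, 0 < C ∧
      ∀ V : E3 → ℝ, LocallyIntegrable V volume → Periodic3 V →
      ∀ ε : ℝ, 0 < ε →
      (∃ N₀ : ℝ, 0 ≤ N₀ ∧ ∀ N : ℝ, N₀ ≤ N →
        ksNorm (fun x =>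
          (‖Set.indicator Ω3 (fun y => if N < |V y| then V y else 0) x‖₊ : ℝ≥0∞))
          < ENNReal.ofReal ε) →
      ∃ K : ℝ≥0,
        ∀ ψ : E3 → ℂ, ContDiff ℝ 1 ψ → HasCompactSupport ψ →
          (∫⁻ x, (‖ψ x‖₊ : ℝ≥0∞) ^ 2 * (‖V x‖₊ : ℝ≥0∞)) ≤
            C * ENNReal.ofReal ε * (∫⁻ x, (‖fderiv ℝ ψ x‖₊ : ℝ≥0∞) ^ 2)
            + K * (∫⁻ x, (‖ψ x‖₊ : ℝ≥0∞) ^ 2) := by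
  refine ⟨2 ^ 21, by positivity, fun V hV hper ε hε ⟨N, hN, hks⟩ => ?_⟩
  set w : E3 → ℝ≥0∞ := fun x => ‖if N < |V x| then V x else 0‖ₑ with hw
  have hwV : ∀ x, w x ≤ ‖V x‖ₑ := fun x => by
    simp only [hw]
    split_ifs
    · exact le_rfl
    · simp
  have hVw : ∀ x, ‖V x‖ₑ ≤ N.toNNReal + w x := fun x => by
    simp only [hw]
    split_ifs with h
    · exact le_add_self
    · rw [enorm_zero, add_zero, ← ofReal_norm]
      exact ENNReal.ofReal_le_ofReal (not_lt.mp h)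
  have hw_meas : AEMeasurable w volume := by
    have hf : Measurable fun v : ℝ => ‖if N < |v| then v else 0‖ₑ :=
      (Measurable.ite (measurableSet_lt measurable_const measurable_id.abs) measurable_id
        measurable_const).enorm
    exact hf.comp_aemeasurable hV.aestronglyMeasurable.aemeasurable
  have hw_per : Periodic3 w := fun x n => by simp only [hw, hper x n]
  have hΩ : ∫⁻ x in Ω3, w x ≠ ∞ :=
    ne_top_of_le_ne_top (lintegral_Ω3_enorm_ne_top hV) (lintegral_mono hwV)
  have hu : Set.EqOn (fun x =>
      (‖Set.indicator Ω3 (fun y => if N < |V y| then V y else 0) x‖₊ : ℝ≥0∞)) w Ω3 :=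
    fun x hx => by simp only [Set.indicator_of_mem hx, hw, enorm_eq_nnnorm]
  have hK : 2 * (esize 0)⁻¹ ^ 3 * (∫⁻ x in Ω3, w x) ≠ ∞ :=
    ENNReal.mul_ne_top (ENNReal.mul_ne_top ofNat_ne_top
      (ENNReal.pow_ne_top (ENNReal.inv_ne_top.mpr (esize_ne_zero 0)))) hΩ
  refine ⟨N.toNNReal + (2 * (esize 0)⁻¹ ^ 3 * ∫⁻ x in Ω3, w x).toNNReal, fun ψ hψ hsupp => ?_⟩
  rw [ENNReal.coe_add, ENNReal.coe_toNNReal hK]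
  simp only [← enorm_eq_nnnorm]
  have hm : Measurable fun x => ‖ψ x‖ₑ ^ 2 := hψ.continuous.enorm.measurable.pow_const 2
  calc ∫⁻ x, ‖ψ x‖ₑ ^ 2 * ‖V x‖ₑ
      ≤ ∫⁻ x, (N.toNNReal * ‖ψ x‖ₑ ^ 2 + ‖ψ x‖ₑ ^ 2 * w x) := lintegral_mono fun x =>
        (mul_le_mul' le_rfl (hVw x)).trans_eq (by ring)
    _ = N.toNNReal * (∫⁻ x, ‖ψ x‖ₑ ^ 2) + ∫⁻ x, ‖ψ x‖ₑ ^ 2 * w x := by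
        rw [lintegral_add_left (hm.const_mul _), lintegral_const_mul _ hm]
    _ ≤ N.toNNReal * (∫⁻ x, ‖ψ x‖ₑ ^ 2) + (2 ^ 21 * ε.toNNReal * (∫⁻ x, ‖fderiv ℝ ψ x‖ₑ ^ 2)
        + 2 * (esize 0)⁻¹ ^ 3 * (∫⁻ x in Ω3, w x) * ∫⁻ x, ‖ψ x‖ₑ ^ 2) := by
        refine add_le_add le_rfl (lintegral_sq_mul_le_of_ksNorm_le (Real.toNNReal_pos.mpr hε)
          hw_meas (fun x => enorm_ne_top) hw_per hu (hks N le_rfl).le hΩ hψ ?_)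
        exact ne_top_of_le_ne_top (lintegral_sq_mul_enorm_ne_top hV hψ.continuous hsupp)
          (lintegral_mono fun x => mul_le_mul' le_rfl (hwV x))
    _ = _ := by
        push_cast
        rw [ENNReal.ofReal]
        ring
end
end

section
/- There is an absolute constant C > 0 such that for all nonnegative measurable functions w₁, w₂ on ℝ³ with ‖w₁‖_F < ∞ and ‖w₂‖_F < ∞, one has ‖w₁ + w₂‖_F ≤ C (‖w₁‖_F + ‖w₂‖_F). -/
open MeasureTheory ENNReal NNReal Real Filter
open scoped Classical

noncomputable section

/-- A double integral against a factored kernel is an integral of squares. -/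
theorem lintegral_lintegral_factored_kernel {X Y : Type*} [MeasurableSpace X] [MeasurableSpace Y]
    (μ : Measure X) [SFinite μ] (ν : Measure Y) [SFinite ν] {w : X → ℝ≥0∞} (hw : Measurable w)
    {φ : X → Y → ℝ≥0∞} (hφ : Measurable (Function.uncurry φ)) :
    ∫⁻ x, ∫⁻ y, w x * w y * (∫⁻ p, φ x p * φ y p ∂ν) ∂μ ∂μ
      = ∫⁻ p, (∫⁻ x, w x * φ x p ∂μ) ^ 2 ∂ν := by
  have hf : Measurable (Function.uncurry fun x p => w x * φ x p) :=
    (hw.comp measurable_fst).mul hφ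
  have hfx (x : X) : Measurable fun p => w x * φ x p := hf.comp measurable_prodMk_left
  have hfp (p : Y) : Measurable fun x => w x * φ x p := hf.comp measurable_prodMk_right
  have hint : Measurable fun p => ∫⁻ x, w x * φ x p ∂μ :=
    Measurable.lintegral_prod_left' (f := fun q : X × Y => w q.1 * φ q.1 q.2) hf
  calc
    _ = ∫⁻ x, ∫⁻ y, ∫⁻ p, (w x * φ x p) * (w y * φ y p) ∂ν ∂μ ∂μ := by
      refine lintegral_congr fun x => lintegral_congr fun y => ?_
      have hx : Measurable (φ x) := hφ.comp measurable_prodMk_left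
      have hy : Measurable (φ y) := hφ.comp measurable_prodMk_left
      refine (lintegral_const_mul _ (hx.mul hy)).symm.trans (lintegral_congr fun p => ?_)
      simp only [Pi.mul_apply]
      ring
    _ = ∫⁻ x, ∫⁻ p, (w x * φ x p) * (∫⁻ y, w y * φ y p ∂μ) ∂ν ∂μ := by
      refine lintegral_congr fun x => ?_
      rw [lintegral_lintegral_swap]
      · exact lintegral_congr fun p => lintegral_const_mul _ (hfp p)
      · exact (((hfx x).comp measurable_snd).mul hf).aemeasurable
    _ = ∫⁻ p, ∫⁻ x, (w x * φ x p) * (∫⁻ y, w y * φ y p ∂μ) ∂μ ∂ν :=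
      lintegral_lintegral_swap (hf.mul (hint.comp measurable_snd)).aemeasurable
    _ = _ := by
      refine lintegral_congr fun p => ?_
      rw [lintegral_mul_const _ (hfp p), sq]

/-- The measure `s³ ds dz` on scales `1/s` and centers `z` of balls. -/
def scaleMeasure : Measure (ℝ × E3) :=
  ((volume.restrict (Set.Ioi 0)).withDensity fun s => ENNReal.ofReal (s ^ 3)).prod volume

instance : SFinite scaleMeasure := by unfold scaleMeasure; infer_instance

/-- The indicator of `x` lying in the ball of radius `1/s` around `z`, where `p = (s, z)`. -/
def ballIndicator (x : E3) (p : ℝ × E3) : ℝ≥0∞ := if p.1 * dist x p.2 < 1 then 1 else 0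

theorem measurable_ballIndicator : Measurable (Function.uncurry ballIndicator) := by
  refine Measurable.ite (measurableSet_lt ?_ measurable_const) measurable_const measurable_const
  fun_prop

theorem lintegral_ballIndicator_mul (x y : E3) :
    ∫⁻ p, ballIndicator x p * ballIndicator y p ∂scaleMeasure
      = ∫⁻ s in Set.Ioi (0 : ℝ), ENNReal.ofReal (s ^ 3) *
          volume (Metric.ball x s⁻¹ ∩ Metric.ball y s⁻¹) := by
  have hx : Measurable (ballIndicator x) := measurable_ballIndicator.comp measurable_prodMk_left
  have hy : Measurable (ballIndicator y) := measurable_ballIndicator.comp measurable_prodMk_left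
  have hxy : Measurable fun p => ballIndicator x p * ballIndicator y p := hx.mul hy
  rw [scaleMeasure, lintegral_prod _ hxy.aemeasurable,
    lintegral_withDensity_eq_lintegral_mul _ (by fun_prop) hxy.lintegral_prod_right']
  refine setLIntegral_congr_fun measurableSet_Ioi fun s (hs : 0 < s) => ?_
  simp only [Pi.mul_apply]
  rw [← lintegral_indicator_one (Metric.isOpen_ball.inter Metric.isOpen_ball).measurableSet]
  congr 1
  refine lintegral_congr fun z => ?_
  simp only [ballIndicator, Set.indicator, Set.mem_inter_iff, Metric.mem_ball, dist_comm z,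
    Pi.one_apply, ← lt_inv_mul_iff₀ hs, mul_one]
  split_ifs <;> simp_all

theorem volume_Ioi_inter_mul_dist_lt (x y : E3) {c : ℝ} (hc : 0 < c) :
    volume (Set.Ioi (0 : ℝ) ∩ {s | s * dist x y < c}) = ENNReal.ofReal c / edist x y := by
  rcases eq_or_ne x y with rfl | h
  · have : Set.Ioi (0 : ℝ) ∩ {s | s * dist x x < c} = Set.Ioi 0 := by
      ext s; simp [hc]
    rw [this, edist_self, ENNReal.div_zero (by simpa using hc)]
    simp
  · have hd : 0 < dist x y := dist_pos.2 h
    have : Set.Ioi (0 : ℝ) ∩ {s | s * dist x y < c} = Set.Ioo 0 (c / dist x y) := by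
      ext s; simp [lt_div_iff₀ hd]
    rw [this, Real.volume_Ioo, sub_zero, ENNReal.ofReal_div_of_pos hd, edist_dist]

theorem volume_ball_E3 (x : E3) {r : ℝ} (hr : 0 ≤ r) :
    volume (Metric.ball x r) = ENNReal.ofReal (r ^ 3) * volume (Metric.ball (0 : E3) 1) := by
  simpa using Measure.addHaar_ball (volume : Measure E3) x hr

/-- The factored kernel dominates the Newtonian kernel. -/
theorem le_lintegral_ballIndicator_mul (x y : E3) :
    ENNReal.ofReal (1 / 8) * volume (Metric.ball (0 : E3) 1) * (edist x y)⁻¹ ≤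
      ∫⁻ p, ballIndicator x p * ballIndicator y p ∂scaleMeasure := by
  rw [lintegral_ballIndicator_mul]
  have hS : MeasurableSet {s : ℝ | s * dist x y < 1} :=
    measurableSet_lt (by fun_prop) measurable_const
  have hvol := volume_Ioi_inter_mul_dist_lt x y one_pos
  rw [ENNReal.ofReal_one, one_div] at hvol
  rw [← hvol, ← setLIntegral_const]
  refine (setLIntegral_mono' (measurableSet_Ioi.inter hS) ?_).trans
    (lintegral_mono_set Set.inter_subset_left)
  rintro s ⟨hs, hsd⟩
  replace hs : 0 < s := hs
  have hd : dist x y < s⁻¹ := by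
    rw [← one_div, lt_div_iff₀ hs, mul_comm]; exact hsd
  have hxm : dist x (midpoint ℝ x y) = dist x y / 2 := by
    rw [dist_left_midpoint]; norm_num; ring
  have hym : dist y (midpoint ℝ x y) = dist x y / 2 := by
    rw [dist_right_midpoint]; norm_num; ring
  have hsub : Metric.ball (midpoint ℝ x y) (s⁻¹ / 2) ⊆
      Metric.ball x s⁻¹ ∩ Metric.ball y s⁻¹ := by
    refine Set.subset_inter (Metric.ball_subset_ball' ?_) (Metric.ball_subset_ball' ?_)
    · rw [dist_comm, hxm]; linarith
    · rw [dist_comm, hym]; linarith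
  calc
    _ = ENNReal.ofReal (s ^ 3) * volume (Metric.ball (midpoint ℝ x y) (s⁻¹ / 2)) := by
      rw [volume_ball_E3 (midpoint ℝ x y) (by positivity), ← mul_assoc,
        ← ENNReal.ofReal_mul (by positivity)]
      have : s ^ 3 * (s⁻¹ / 2) ^ 3 = 1 / 8 := by
        field_simp
        norm_num
      rw [this]
    _ ≤ _ := by gcongr

/-- The factored kernel is dominated by the Newtonian kernel. -/
theorem lintegral_ballIndicator_mul_le (x y : E3) :
    ∫⁻ p, ballIndicator x p * ballIndicator y p ∂scaleMeasure ≤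
      2 * volume (Metric.ball (0 : E3) 1) * (edist x y)⁻¹ := by
  rw [lintegral_ballIndicator_mul]
  have hS : MeasurableSet {s : ℝ | s * dist x y < 2} :=
    measurableSet_lt (by fun_prop) measurable_const
  have hvol := volume_Ioi_inter_mul_dist_lt x y two_pos
  calc
    _ ≤ ∫⁻ s in Set.Ioi (0 : ℝ), {s : ℝ | s * dist x y < 2}.indicator
          (fun _ => volume (Metric.ball (0 : E3) 1)) s := by
      refine setLIntegral_mono' measurableSet_Ioi fun s (hs : 0 < s) => ?_
      by_cases h : s * dist x y < 2
      · rw [Set.indicator_of_mem (by exact h)]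
        calc
          _ ≤ ENNReal.ofReal (s ^ 3) * volume (Metric.ball x s⁻¹) := by
            gcongr; exact Set.inter_subset_left
          _ = _ := by
            rw [volume_ball_E3 _ (by positivity), ← mul_assoc, ← ENNReal.ofReal_mul (by positivity),
              ← mul_pow, mul_inv_cancel₀ hs.ne', one_pow, ENNReal.ofReal_one, one_mul]
      · have hdisj : Disjoint (Metric.ball x s⁻¹) (Metric.ball y s⁻¹) := by
          refine Metric.ball_disjoint_ball ?_
          rw [← two_mul, ← div_eq_mul_inv, div_le_iff₀ hs, mul_comm]
          exact not_lt.1 h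
        simp [Set.disjoint_iff_inter_eq_empty.1 hdisj]
    _ = _ := by
      rw [setLIntegral_indicator hS, setLIntegral_const, Set.inter_comm, hvol, ENNReal.div_eq_inv_mul]
      simp only [ENNReal.ofReal_ofNat]
      ring

/-- The Newtonian energy is quasi-subadditive. -/
theorem lintegral_lintegral_div_edist_add_le (μ : Measure E3) [SFinite μ] {w₁ w₂ : E3 → ℝ≥0∞}
    (h₁ : Measurable w₁) (h₂ : Measurable w₂) :
    ∫⁻ x, ∫⁻ y, (w₁ x + w₂ x) * (w₁ y + w₂ y) / edist x y ∂μ ∂μ ≤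
      32 * (∫⁻ x, ∫⁻ y, w₁ x * w₁ y / edist x y ∂μ ∂μ +
        ∫⁻ x, ∫⁻ y, w₂ x * w₂ y / edist x y ∂μ ∂μ) := by
  set v := volume (Metric.ball (0 : E3) 1)
  have hv0 : v ≠ 0 := (Metric.measure_ball_pos _ _ one_pos).ne'
  have hvt : v ≠ ⊤ := measure_ball_lt_top.ne
  let F (w : E3 → ℝ≥0∞) (p : ℝ × E3) := ∫⁻ x, w x * ballIndicator x p ∂μ
  have hm {w : E3 → ℝ≥0∞} (hw : Measurable w) (p : ℝ × E3) :
      Measurable fun x => w x * ballIndicator x p :=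
    hw.mul (measurable_ballIndicator.comp measurable_prodMk_right)
  have hF {w : E3 → ℝ≥0∞} (hw : Measurable w) : Measurable (F w) :=
    Measurable.lintegral_prod_left' (f := fun q : E3 × (ℝ × E3) => w q.1 * ballIndicator q.1 q.2)
      ((hw.comp measurable_fst).mul measurable_ballIndicator)
  have hpull (c : ℝ≥0∞) {w : E3 → ℝ≥0∞} (hw : Measurable w) :
      c * ∫⁻ x, ∫⁻ y, w x * w y / edist x y ∂μ ∂μ =
        ∫⁻ x, ∫⁻ y, w x * w y * (c * (edist x y)⁻¹) ∂μ ∂μ := by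
    have hk : Measurable fun q : E3 × E3 => w q.1 * w q.2 / edist q.1 q.2 := by fun_prop
    rw [← lintegral_const_mul _ hk.lintegral_prod_right']
    refine lintegral_congr fun x => ?_
    refine (lintegral_const_mul _ (hk.comp measurable_prodMk_left)).symm.trans
      (lintegral_congr fun y => ?_)
    simp only [Function.comp_apply, div_eq_mul_inv]
    ring
  have hlow {w : E3 → ℝ≥0∞} (hw : Measurable w) :
      ENNReal.ofReal (1 / 8) * v * ∫⁻ x, ∫⁻ y, w x * w y / edist x y ∂μ ∂μ ≤
        ∫⁻ p, F w p ^ 2 ∂scaleMeasure := by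
    rw [hpull _ hw, ← lintegral_lintegral_factored_kernel μ _ hw measurable_ballIndicator]
    gcongr with x y
    exact le_lintegral_ballIndicator_mul x y
  have hup {w : E3 → ℝ≥0∞} (hw : Measurable w) :
      ∫⁻ p, F w p ^ 2 ∂scaleMeasure ≤
        2 * v * ∫⁻ x, ∫⁻ y, w x * w y / edist x y ∂μ ∂μ := by
    rw [hpull _ hw, ← lintegral_lintegral_factored_kernel μ _ hw measurable_ballIndicator]
    gcongr with x y
    exact lintegral_ballIndicator_mul_le x y
  have hsq : ∫⁻ p, F (fun x => w₁ x + w₂ x) p ^ 2 ∂scaleMeasure ≤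
      2 * (∫⁻ p, F w₁ p ^ 2 ∂scaleMeasure + ∫⁻ p, F w₂ p ^ 2 ∂scaleMeasure) := by
    rw [← lintegral_add_left ((hF h₁).pow_const 2), ← lintegral_const_mul _ (by
      exact ((hF h₁).pow_const 2).add ((hF h₂).pow_const 2))]
    refine lintegral_mono fun p => ?_
    have hadd : F (fun x => w₁ x + w₂ x) p = F w₁ p + F w₂ p := by
      simp only [F, add_mul]
      exact lintegral_add_left (hm h₁ p) _
    rw [hadd]
    simpa [one_add_one_eq_two, show (2 : ℝ) - 1 = 1 by norm_num] using
      ENNReal.rpow_add_le_mul_rpow_add_rpow (F w₁ p) (F w₂ p) (p := 2) (by norm_num)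
  have hc0 : ENNReal.ofReal (1 / 8) * v ≠ 0 := mul_ne_zero (by simp) hv0
  have hct : ENNReal.ofReal (1 / 8) * v ≠ ⊤ := ENNReal.mul_ne_top ENNReal.ofReal_ne_top hvt
  refine (ENNReal.mul_le_mul_iff_right hc0 hct).1 ?_
  have h32 : ENNReal.ofReal (1 / 8) * 32 = 4 := by
    rw [← ENNReal.ofReal_ofNat 32, ← ENNReal.ofReal_mul (by norm_num)]
    norm_num
  calc
    _ ≤ _ := hlow (h₁.add h₂)
    _ ≤ _ := hsq
    _ ≤ 2 * (2 * v * (∫⁻ x, ∫⁻ y, w₁ x * w₁ y / edist x y ∂μ ∂μ) +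
        2 * v * ∫⁻ x, ∫⁻ y, w₂ x * w₂ y / edist x y ∂μ ∂μ) := by
      gcongr
      exacts [hup h₁, hup h₂]
    _ = 4 * v * (∫⁻ x, ∫⁻ y, w₁ x * w₁ y / edist x y ∂μ ∂μ +
        ∫⁻ x, ∫⁻ y, w₂ x * w₂ y / edist x y ∂μ ∂μ) := by ring
    _ = _ := by rw [← h32]; ring

/-- A cube of finite mass has energy at most the Kerman–Sawyer norm times the mass. -/
theorem energy_le_ksNorm_mul {w : E3 → ℝ≥0∞} (hw : ksNorm w < ⊤) (z : E3) {r : ℝ} (hr : 0 < r)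
    (hfin : ∫⁻ x in cube3 z r, w x ≠ ⊤) :
    ∫⁻ x in cube3 z r, ∫⁻ y in cube3 z r, w x * w y / edist x y ≤
      ksNorm w * ∫⁻ x in cube3 z r, w x := by
  have h : ksRatio w z r ≤ ksNorm w := le_iSup₂_of_le z r (le_iSup_of_le hr le_rfl)
  unfold ksRatio at h
  rcases eq_or_ne (∫⁻ x in cube3 z r, w x) 0 with h0 | h0
  · rw [h0, ENNReal.inv_zero] at h
    have : ∫⁻ x in cube3 z r, ∫⁻ y in cube3 z r, w x * w y / edist x y = 0 := by
      by_contra hne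
      exact absurd (h.trans_lt hw) (by simp [ENNReal.top_mul hne])
    simp [this]
  · rwa [mul_comm, ← ENNReal.div_eq_inv_mul.trans (mul_comm _ _), ENNReal.div_le_iff h0 hfin] at h

/-- Quasi-subadditivity of the Kerman–Sawyer norm. -/
theorem stmt6 :
    ∃ C : ℝ≥0, 0 < C ∧ ∀ w₁ w₂ : E3 → ℝ≥0∞, Measurable w₁ → Measurable w₂ →
      ksNorm w₁ < ⊤ → ksNorm w₂ < ⊤ →
      ksNorm (fun x => w₁ x + w₂ x) ≤ C * (ksNorm w₁ + ksNorm w₂) := by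
  refine ⟨32, by norm_num, fun w₁ w₂ h₁ h₂ hA₁ hA₂ => ?_⟩
  refine iSup₂_le fun z r => iSup_le fun hr => ?_
  unfold ksRatio
  rw [lintegral_add_left h₁]
  set m₁ := ∫⁻ x in cube3 z r, w₁ x
  set m₂ := ∫⁻ x in cube3 z r, w₂ x
  rcases eq_or_ne (m₁ + m₂) ⊤ with htop | htop
  · simp [htop]
  obtain ⟨hm₁, hm₂⟩ := ENNReal.add_ne_top.1 htop
  have hE := lintegral_lintegral_div_edist_add_le (volume.restrict (cube3 z r)) h₁ h₂
  have hE₁ := energy_le_ksNorm_mul hA₁ z hr hm₁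
  have hE₂ := energy_le_ksNorm_mul hA₂ z hr hm₂
  calc
    _ ≤ (m₁ + m₂)⁻¹ * (32 * (ksNorm w₁ * m₁ + ksNorm w₂ * m₂)) := by
      gcongr
      exact hE.trans (by gcongr)
    _ ≤ (m₁ + m₂)⁻¹ * (32 * ((ksNorm w₁ + ksNorm w₂) * (m₁ + m₂))) := by
      rw [add_mul]
      gcongr <;> simp
    _ = 32 * (ksNorm w₁ + ksNorm w₂) * ((m₁ + m₂)⁻¹ * (m₁ + m₂)) := by ring
    _ ≤ 32 * (ksNorm w₁ + ksNorm w₂) * 1 := by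
      gcongr
      exact ENNReal.inv_mul_le_one _
    _ = _ := by simp
end
end

section
/- Let A be a real symmetric positive-definite 3×3 matrix. There is a constant C (depending only on A) such that for every real number k ≥ 1 and every n ∈ ℤ³, one has |n|² + 1 ≤ C ( (nAnᵀ − k²)² + 4k² ). Consequently, for every finitely supported family (a_n) of complex coefficients, Σ_n (|n|² + 1)|a_n|² ≤ C Σ_n |nAnᵀ − k² − 2ik|² |a_n|², i.e. ‖Dφ‖²_{L²(𝕋³)} + ‖φ‖²_{L²(𝕋³)} ≤ C ‖(DAD^T − k² − 2ik)φ‖²_{L²(𝕋³)} for trigonometric polynomials φ = Σ_n a_n e^{in·x}. -/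
open MeasureTheory ENNReal NNReal Real Filter
open scoped Classical

noncomputable section

theorem qA_pos {A : Matrix (Fin 3) (Fin 3) ℝ} (hA : A.PosDef) {v : Fin 3 → ℝ} (hv : v ≠ 0) :
    0 < qA A v := by
  have h := hA.dotProduct_mulVec_pos hv
  simpa [qA, dotProduct, Matrix.mulVec, Finset.mul_sum, mul_assoc] using h

theorem qA_smul (A : Matrix (Fin 3) (Fin 3) ℝ) (r : ℝ) (v : Fin 3 → ℝ) :
    qA A (r • v) = r ^ 2 * qA A v := by
  simp only [qA, Pi.smul_apply, smul_eq_mul, Finset.mul_sum]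
  exact Finset.sum_congr rfl fun i _ => Finset.sum_congr rfl fun j _ => by ring

theorem continuous_qA (A : Matrix (Fin 3) (Fin 3) ℝ) : Continuous (qA A) := by
  unfold qA
  fun_prop

/-- A positive-definite quadratic form is coercive. -/
theorem exists_sum_sq_le_qA {A : Matrix (Fin 3) (Fin 3) ℝ} (hA : A.PosDef) :
    ∃ K : ℝ, 0 < K ∧ ∀ v : Fin 3 → ℝ, ∑ i, v i ^ 2 ≤ K * qA A v := by
  obtain ⟨u, hu, hmin⟩ := (isCompact_sphere (0 : Fin 3 → ℝ) 1).exists_isMinOn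
    (NormedSpace.sphere_nonempty.mpr zero_le_one) (continuous_qA A).continuousOn
  have hu0 : u ≠ 0 := by
    rintro rfl
    simp at hu
  have hm : 0 < qA A u := qA_pos hA hu0
  refine ⟨3 / qA A u, by positivity, fun v => ?_⟩
  rcases eq_or_ne v 0 with rfl | hv
  · simp [qA]
  have hv' : 0 < ‖v‖ := norm_pos_iff.mpr hv
  have hle : qA A u ≤ qA A (‖v‖⁻¹ • v) := hmin (by simp [norm_smul, hv'.ne'])
  have hlow : qA A u * ‖v‖ ^ 2 ≤ qA A v := by
    rw [qA_smul, inv_pow, ← div_eq_inv_mul] at hle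
    exact (le_div_iff₀ (by positivity)).mp hle
  have hsum : ∑ i, v i ^ 2 ≤ 3 * ‖v‖ ^ 2 := by
    calc ∑ i, v i ^ 2 ≤ ∑ _i : Fin 3, ‖v‖ ^ 2 :=
          Finset.sum_le_sum fun i _ => sq_le_sq' (neg_le_of_abs_le (norm_le_pi_norm v i))
            (le_of_abs_le (norm_le_pi_norm v i))
      _ = 3 * ‖v‖ ^ 2 := by simp
  rw [div_mul_eq_mul_div, le_div_iff₀ hm]
  nlinarith

theorem norm_sq_symbol (q k : ℝ) :
    ‖(q : ℂ) - (k : ℂ) ^ 2 - 2 * Complex.I * (k : ℂ)‖ ^ 2 = (q - k ^ 2) ^ 2 + 4 * k ^ 2 := by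
  have h : (q : ℂ) - (k : ℂ) ^ 2 - 2 * Complex.I * (k : ℂ)
      = ((q - k ^ 2 : ℝ) : ℂ) + ((-2 * k : ℝ) : ℂ) * Complex.I := by
    push_cast
    ring
  rw [h, Complex.sq_norm, Complex.normSq_add_mul_I]
  ring

/-- Lower bound `|n|² + 1 ≤ C((nAnᵀ − k²)² + 4k²)` and the resulting a priori estimate
`‖Dφ‖² + ‖φ‖² ≤ C‖(DADᵀ − k² − 2ik)φ‖²` for trigonometric polynomials. -/
theorem stmt14 :
    ∀ A : Matrix (Fin 3) (Fin 3) ℝ, A.IsSymm → A.PosDef →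
      ∃ C : ℝ, 0 < C ∧
        ∀ k : ℝ, 1 ≤ k →
          (∀ n : Fin 3 → ℤ,
            (∑ i, ((n i : ℝ)) ^ 2) + 1 ≤
              C * ((qA A (fun i => (n i : ℝ)) - k ^ 2) ^ 2 + 4 * k ^ 2)) ∧
          (∀ a : (Fin 3 → ℤ) →₀ ℂ,
            (∑ n ∈ a.support, ((∑ i, ((n i : ℝ)) ^ 2) + 1) * ‖a n‖ ^ 2) ≤
              C * ∑ n ∈ a.support,
                ‖(((qA A (fun i => (n i : ℝ)) : ℝ) : ℂ) - (k : ℂ) ^ 2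
                    - 2 * Complex.I * (k : ℂ))‖ ^ 2 * ‖a n‖ ^ 2) := by
  intro A _ hA
  obtain ⟨K, hK, hKq⟩ := exists_sum_sq_le_qA hA
  refine ⟨K + 1, by positivity, fun k hk => ?_⟩
  have hbound : ∀ n : Fin 3 → ℤ, (∑ i, ((n i : ℝ)) ^ 2) + 1 ≤
      (K + 1) * ((qA A (fun i => (n i : ℝ)) - k ^ 2) ^ 2 + 4 * k ^ 2) := by
    intro n
    have hs := hKq (fun i => (n i : ℝ))
    have hs0 : 0 ≤ ∑ i, ((n i : ℝ)) ^ 2 := by positivity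
    set q := qA A (fun i => (n i : ℝ))
    have hq : 0 ≤ q := nonneg_of_mul_nonneg_right (hs0.trans hs) hK
    have hk2 : 1 ≤ k ^ 2 := one_le_pow₀ hk
    have hlow : q + 1 ≤ (q - k ^ 2) ^ 2 + 4 * k ^ 2 := by
      nlinarith [sq_nonneg (q - k ^ 2 - 1)]
    calc (∑ i, ((n i : ℝ)) ^ 2) + 1 ≤ (K + 1) * (q + 1) := by nlinarith
      _ ≤ _ := by gcongr
  refine ⟨hbound, fun a => ?_⟩
  rw [Finset.mul_sum]
  refine Finset.sum_le_sum fun n _ => ?_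
  rw [norm_sq_symbol, ← mul_assoc]
  exact mul_le_mul_of_nonneg_right (hbound n) (by positivity)
end
end

section
/- For every z ∈ ℂ \ (−∞, 0] and every x ∈ ℝ³ with x ≠ 0, the improper integral lim_{R→∞} ∫_{|y| ≤ R} e^{−i x·y} / (|y|² + z) dy exists and equals 2π² e^{−√z |x|} / |x|, where √z is the principal square root (so Re √z > 0). -/
open MeasureTheory ENNReal NNReal Real Filter
open scoped Classical

noncomputable section

lemma exists_measurableEquiv_cylindrical (x : E3) (hx : x ≠ 0) :
    ∃ e : E3 ≃ᵐ ℝ × EuclideanSpace ℝ (Fin 2), MeasurePreserving e volume volume ∧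
      ∀ y, ∑ i, x i * y i = ‖x‖ * (e y).1 ∧ ‖y‖ ^ 2 = (e y).1 ^ 2 + ‖(e y).2‖ ^ 2 := by
  have hr : ‖x‖ ≠ 0 := norm_ne_zero_iff.mpr hx
  obtain ⟨b, hb⟩ := Orthonormal.exists_orthonormalBasis_extension_of_card_eq (𝕜 := ℝ)
    (E := E3) (ι := Fin 3) (by simp) (v := fun _ => (‖x‖⁻¹ : ℝ) • x) (s := {0})
    (by
      rw [orthonormal_iff_ite]
      rintro ⟨i, hi⟩ ⟨j, hj⟩
      obtain rfl : i = 0 := hi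
      obtain rfl : j = 0 := hj
      simp [norm_smul, hr])
  have hb0 : b 0 = (‖x‖⁻¹ : ℝ) • x := hb 0 rfl
  let e1 : E3 ≃ᵐ E3 := b.measurableEquiv
  let e2 : E3 ≃ᵐ (Fin 3 → ℝ) := (MeasurableEquiv.toLp 2 (Fin 3 → ℝ)).symm
  let e3 : (Fin 3 → ℝ) ≃ᵐ ℝ × (Fin 2 → ℝ) := MeasurableEquiv.piFinSuccAbove (fun _ => ℝ) 0
  let e4 : ℝ × (Fin 2 → ℝ) ≃ᵐ ℝ × EuclideanSpace ℝ (Fin 2) :=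
    (MeasurableEquiv.refl ℝ).prodCongr (MeasurableEquiv.toLp 2 (Fin 2 → ℝ))
  have m1 : MeasurePreserving e1 := b.measurePreserving_measurableEquiv
  have m2 : MeasurePreserving e2 := PiLp.volume_preserving_ofLp (Fin 3)
  have m3 : MeasurePreserving e3 := volume_preserving_piFinSuccAbove (fun _ => ℝ) 0
  have m4 : MeasurePreserving e4 :=
    (MeasurePreserving.id volume).prod (PiLp.volume_preserving_toLp (Fin 2))
  refine ⟨((e1.trans e2).trans e3).trans e4, ((m4.comp m3).comp m2).comp m1, fun y => ?_⟩
  have h1 : ((((e1.trans e2).trans e3).trans e4) y).1 = b.repr y 0 := rfl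
  have h2 : ((((e1.trans e2).trans e3).trans e4) y).2
    = WithLp.toLp 2 (fun i : Fin 2 => b.repr y i.succ) := rfl
  constructor
  · rw [h1, b.repr_apply_apply, hb0, real_inner_smul_left, mul_inv_cancel_left₀ hr]
    simp [PiLp.inner_apply, mul_comm]
  · rw [h1, h2, ← b.repr.norm_map y, EuclideanSpace.norm_sq_eq, EuclideanSpace.norm_sq_eq,
      Fin.sum_univ_succ]
    simp

lemma ofReal_add_mem_slitPlane {z : ℂ} (hz : z ∈ Complex.slitPlane) {s : ℝ} (hs : 0 ≤ s) :
    (s : ℂ) + z ∈ Complex.slitPlane := by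
  rw [Complex.mem_slitPlane_iff] at *
  simp only [Complex.add_re, Complex.ofReal_re, Complex.add_im, Complex.ofReal_im, zero_add]
  exact hz.imp (fun h => by linarith) id

lemma hasDerivAt_log_sq_add {z : ℂ} (hz : z ∈ Complex.slitPlane) (t : ℝ) :
    HasDerivAt (fun t : ℝ => Complex.log ((t : ℂ) ^ 2 + z)) (2 * t / ((t : ℂ) ^ 2 + z)) t := by
  have h : HasDerivAt (fun t : ℝ => (t : ℂ) ^ 2 + z) (2 * t) t := by
    simpa using ((Complex.ofRealCLM.hasDerivAt (x := t)).pow 2).add_const z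
  exact h.clog_real (by exact_mod_cast ofReal_add_mem_slitPlane hz (sq_nonneg t))

lemma sq_add_ne_zero {z : ℂ} (hz : z ∈ Complex.slitPlane) (t : ℝ) : (t : ℂ) ^ 2 + z ≠ 0 :=
  Complex.slitPlane_ne_zero (by exact_mod_cast ofReal_add_mem_slitPlane hz (sq_nonneg t))

lemma integral_id_div_sq_add {z : ℂ} (hz : z ∈ Complex.slitPlane) (c : ℝ) :
    ∫ ρ : ℝ in (0 : ℝ)..c, (ρ : ℂ) / ((ρ : ℂ) ^ 2 + z) =
      (Complex.log ((c : ℂ) ^ 2 + z) - Complex.log z) / 2 := by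
  rw [intervalIntegral.integral_eq_sub_of_hasDerivAt
    (f := fun t : ℝ => Complex.log ((t : ℂ) ^ 2 + z) / 2)]
  · simp
    ring
  · intro t _
    exact ((hasDerivAt_log_sq_add hz t).div_const 2).congr_deriv (by ring)
  · refine Continuous.intervalIntegrable ?_ _ _
    exact Complex.continuous_ofReal.div₀ (by fun_prop) (sq_add_ne_zero hz)

lemma integral_disc_inv_norm_sq_add {z : ℂ} (hz : z ∈ Complex.slitPlane) {s : ℝ} (hs : 0 ≤ s)
    (A : ℝ) :
    ∫ w : EuclideanSpace ℝ (Fin 2),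
        (if s + ‖w‖ ^ 2 ≤ A then 1 / (((s + ‖w‖ ^ 2 : ℝ) : ℂ) + z) else 0) =
      if s ≤ A then π * (Complex.log (A + z) - Complex.log (s + z)) else 0 := by
  split_ifs with h
  · rw [integral_fun_norm_addHaar volume
      (fun ρ : ℝ => if s + ρ ^ 2 ≤ A then 1 / (((s + ρ ^ 2 : ℝ) : ℂ) + z) else 0)]
    have h1 : ∫ ρ in Set.Ioi (0 : ℝ), ρ ^ (Module.finrank ℝ (EuclideanSpace ℝ (Fin 2)) - 1) •
        (if s + ρ ^ 2 ≤ A then 1 / (((s + ρ ^ 2 : ℝ) : ℂ) + z) else 0) =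
        ∫ ρ : ℝ in (0 : ℝ)..√(A - s), (ρ : ℂ) / ((ρ : ℂ) ^ 2 + (s + z)) := by
      rw [intervalIntegral.integral_of_le (sqrt_nonneg _), ← Set.Ioi_inter_Iic, Set.inter_comm,
        ← Measure.restrict_restrict measurableSet_Iic, ← integral_indicator measurableSet_Iic]
      refine setIntegral_congr_fun measurableSet_Ioi fun ρ hρ => ?_
      have hρ' : ρ ≤ √(A - s) ↔ s + ρ ^ 2 ≤ A := by
        rw [le_sqrt' hρ]
        constructor <;> intro <;> linarith
      simp only [Set.indicator_apply, Set.mem_Iic, hρ', finrank_euclideanSpace, Fintype.card_fin]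
      split_ifs
      · simp only [Nat.add_one_sub_one, pow_one, Complex.real_smul]
        push_cast
        ring
      · simp
    rw [h1, integral_id_div_sq_add (ofReal_add_mem_slitPlane hz hs), Measure.real,
      EuclideanSpace.volume_ball_fin_two, ← Complex.ofReal_pow, sq_sqrt (by linarith)]
    simp [Real.pi_pos.le]
    ring_nf
  · refine integral_eq_zero_of_ae (.of_forall fun w => if_neg ?_)
    nlinarith [sq_nonneg ‖w‖]

lemma integrableOn_mul_exp_neg_mul {c : ℂ} (hc : 0 < c.re) :
    IntegrableOn (fun s : ℝ => (s : ℂ) * Complex.exp (-c * s)) (Set.Ioi 0) := by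
  have h := integrableOn_rpow_mul_exp_neg_mul_rpow (p := 1) (s := 1) (by norm_num) one_pos hc
  refine Integrable.mono' h (by fun_prop) ?_
  filter_upwards [ae_restrict_mem measurableSet_Ioi] with s hs
  have hs' : (0 : ℝ) < s := hs
  simp [Complex.norm_exp, abs_of_pos hs']

lemma tendsto_mul_exp_neg_mul {c : ℂ} (hc : 0 < c.re) (p q : ℂ) :
    Tendsto (fun s : ℝ => (p * s + q) * Complex.exp (-c * s)) atTop (nhds 0) := by
  have h1 : Tendsto (fun s : ℝ => (s : ℂ) * Complex.exp (-c * s)) atTop (nhds 0) := by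
    rw [tendsto_zero_iff_norm_tendsto_zero]
    have h := (tendsto_rpow_mul_exp_neg_mul_atTop_nhds_zero 1 c.re hc).norm
    simp only [norm_zero] at h
    refine h.congr fun s => ?_
    simp [Complex.norm_exp]
  have h2 : Tendsto (fun s : ℝ => Complex.exp (-c * s)) atTop (nhds 0) := by
    rw [tendsto_zero_iff_norm_tendsto_zero]
    have h := (tendsto_rpow_mul_exp_neg_mul_atTop_nhds_zero 0 c.re hc).norm
    simp only [norm_zero] at h
    refine h.congr fun s => ?_
    simp [Complex.norm_exp]
  have h3 := (h1.const_mul p).add (h2.const_mul q)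
  simp only [mul_zero, add_zero] at h3
  refine h3.congr fun s => ?_
  ring

lemma integral_mul_exp_neg_mul_Ioi {c : ℂ} (hc : 0 < c.re) :
    ∫ s : ℝ in Set.Ioi 0, (s : ℂ) * Complex.exp (-c * s) = 1 / c ^ 2 := by
  have hc0 : c ≠ 0 := by rintro rfl; simp at hc
  rw [integral_Ioi_of_hasDerivAt_of_tendsto'
    (f := fun s : ℝ => (-1 / c * s + -1 / c ^ 2) * Complex.exp (-c * s)) (m := 0) ?_
    (integrableOn_mul_exp_neg_mul hc) (tendsto_mul_exp_neg_mul hc _ _)]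
  · simp
    ring
  · intro s _
    have h1 : HasDerivAt (fun s : ℝ => (s : ℂ)) 1 s := Complex.ofRealCLM.hasDerivAt
    refine (((h1.const_mul (-1 / c)).add_const (-1 / c ^ 2)).mul
      (h1.const_mul (-c)).cexp).congr_deriv ?_
    field_simp
    ring

lemma integrableOn_Iic_of_comp_neg {E : Type*} [NormedAddCommGroup E] {f : ℝ → E}
    (hf : IntegrableOn (fun s => f (-s)) (Set.Ioi 0)) : IntegrableOn f (Set.Iic 0) := by
  have h := (Measure.measurePreserving_neg (volume : Measure ℝ)).integrableOn_comp_preimage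
    (Homeomorph.neg ℝ).measurableEmbedding (f := f) (s := Set.Iic 0)
  rw [← h, Set.neg_preimage, Set.neg_Iic, neg_zero, integrableOn_Ici_iff_integrableOn_Ioi]
  exact hf

lemma integrable_abs_mul_exp_neg_abs {a : ℂ} (ha : 0 < a.re) :
    Integrable fun s : ℝ => ((|s| : ℝ) : ℂ) * Complex.exp (-a * (|s| : ℝ)) := by
  have h : IntegrableOn (fun s : ℝ => ((|s| : ℝ) : ℂ) * Complex.exp (-a * (|s| : ℝ)))
      (Set.Ioi 0) :=
    (integrableOn_mul_exp_neg_mul ha).congr_fun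
      (fun s hs => by simp only [abs_of_pos (show (0 : ℝ) < s from hs)]) measurableSet_Ioi
  rw [← integrableOn_univ, ← Set.Iic_union_Ioi (a := (0 : ℝ))]
  exact (integrableOn_Iic_of_comp_neg (by simpa only [abs_neg] using h)).union h

/-- The Fourier transform of `|s| e^{-a|s|}`, in the angular frequency normalisation. -/
lemma integral_exp_mul_abs_mul_exp_neg_abs {a : ℂ} (ha : 0 < a.re) (t : ℝ)
    (ht : (t : ℂ) ^ 2 + a ^ 2 ≠ 0) :
    ∫ s : ℝ, Complex.exp (-(t * s : ℝ) * Complex.I) *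
        ((|s| : ℝ) * Complex.exp (-a * (|s| : ℝ))) =
      2 * ((a ^ 2 - (t : ℂ) ^ 2) / ((t : ℂ) ^ 2 + a ^ 2) ^ 2) := by
  have hp : 0 < (a + t * Complex.I).re := by simpa
  have hm : 0 < (a - t * Complex.I).re := by simpa
  have ep : Set.EqOn (fun s : ℝ => Complex.exp (-(t * s : ℝ) * Complex.I) *
      ((|s| : ℝ) * Complex.exp (-a * (|s| : ℝ))))
      (fun s : ℝ => (s : ℂ) * Complex.exp (-(a + t * Complex.I) * s)) (Set.Ioi 0) := by
    intro s hs
    have hs' : (0 : ℝ) < s := hs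
    simp only [abs_of_pos hs']
    rw [mul_left_comm, ← Complex.exp_add]
    push_cast
    ring_nf
  have em : Set.EqOn (fun s : ℝ => Complex.exp (-(t * -s : ℝ) * Complex.I) *
      ((|-s| : ℝ) * Complex.exp (-a * (|-s| : ℝ))))
      (fun s : ℝ => (s : ℂ) * Complex.exp (-(a - t * Complex.I) * s)) (Set.Ioi 0) := by
    intro s hs
    have hs' : (0 : ℝ) < s := hs
    simp only [abs_neg, abs_of_pos hs']
    rw [mul_left_comm, ← Complex.exp_add]
    push_cast
    ring_nf
  have ip := (integrableOn_mul_exp_neg_mul hp).congr_fun ep.symm measurableSet_Ioi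
  have im := (integrableOn_mul_exp_neg_mul hm).congr_fun em.symm measurableSet_Ioi
  rw [← setIntegral_univ, ← Set.Iic_union_Ioi (a := (0 : ℝ)),
    setIntegral_union (Set.Iic_disjoint_Ioi le_rfl) measurableSet_Ioi
      (integrableOn_Iic_of_comp_neg im) ip, ← neg_zero, ← integral_comp_neg_Ioi, neg_zero,
    setIntegral_congr_fun measurableSet_Ioi ep, setIntegral_congr_fun measurableSet_Ioi em,
    integral_mul_exp_neg_mul_Ioi hp, integral_mul_exp_neg_mul_Ioi hm]
  have hfac : (t : ℂ) ^ 2 + a ^ 2 = (a + t * Complex.I) * (a - t * Complex.I) := by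
    linear_combination (t : ℂ) ^ 2 * Complex.I_sq
  rw [hfac] at ht ⊢
  have hp0 := left_ne_zero_of_mul ht
  have hm0 := right_ne_zero_of_mul ht
  field_simp
  linear_combination (2 * (t : ℂ) ^ 2) * Complex.I_sq

lemma integrable_sub_sq_div_sq_add_sq {z : ℂ} (hz : ∀ t : ℝ, (t : ℂ) ^ 2 + z ≠ 0) :
    Integrable fun t : ℝ => (z - (t : ℂ) ^ 2) / ((t : ℂ) ^ 2 + z) ^ 2 := by
  have hc : Continuous fun t : ℝ => (z - (t : ℂ) ^ 2) / ((t : ℂ) ^ 2 + z) ^ 2 :=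
    Continuous.div₀ (by fun_prop) (by fun_prop) fun t => pow_ne_zero 2 (hz t)
  refine hc.locallyIntegrable.integrable_of_isBigO_cocompact (g := fun t : ℝ => (1 + t ^ 2)⁻¹) ?_
    (integrable_inv_one_add_sq.integrableAtFilter _)
  refine Asymptotics.IsBigO.of_bound 16 ?_
  filter_upwards [(tendsto_norm_cocompact_atTop (E := ℝ)).eventually_ge_atTop (2 * ‖z‖ + 1)]
    with t ht
  have hz0 := norm_nonneg z
  have hsq : 2 * ‖z‖ + 1 ≤ t ^ 2 := by
    rw [← sq_abs, ← Real.norm_eq_abs]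
    nlinarith
  have hn : ‖((t : ℂ) ^ 2)‖ = t ^ 2 := by simp
  have h1 : ‖z - (t : ℂ) ^ 2‖ ≤ 2 * t ^ 2 := by
    have := norm_sub_le z ((t : ℂ) ^ 2)
    linarith
  have h2 : t ^ 2 / 2 ≤ ‖(t : ℂ) ^ 2 + z‖ := by
    have := norm_sub_le_norm_add ((t : ℂ) ^ 2) z
    linarith
  rw [norm_div, norm_pow, norm_inv, Real.norm_of_nonneg (by positivity : 0 ≤ 1 + t ^ 2)]
  have ht0 : 0 < t ^ 2 := by linarith
  calc ‖z - (t : ℂ) ^ 2‖ / ‖(t : ℂ) ^ 2 + z‖ ^ 2 ≤ 2 * t ^ 2 / (t ^ 2 / 2) ^ 2 := by gcongr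
    _ = 8 / t ^ 2 := by
      have : t ≠ 0 := by rintro rfl; simp at ht0
      field_simp
      norm_num
    _ ≤ 16 * (1 + t ^ 2)⁻¹ := by
      rw [← div_eq_mul_inv, div_le_div_iff₀ ht0 (by positivity)]
      linarith

lemma integral_exp_mul_sub_sq_div_sq_add_sq {a : ℂ} (ha : 0 < a.re)
    (hz : ∀ t : ℝ, (t : ℂ) ^ 2 + a ^ 2 ≠ 0) (r : ℝ) :
    ∫ t : ℝ, Complex.exp (-(r * t : ℝ) * Complex.I) *
        ((a ^ 2 - (t : ℂ) ^ 2) / ((t : ℂ) ^ 2 + a ^ 2) ^ 2) =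
      π * ((|r| : ℝ) * Complex.exp (-a * (|r| : ℝ))) := by
  set f : ℝ → ℂ := fun s => (|s| : ℝ) * Complex.exp (-a * (|s| : ℝ)) with hf
  set g : ℝ → ℂ := fun t => (a ^ 2 - (t : ℂ) ^ 2) / ((t : ℂ) ^ 2 + a ^ 2) ^ 2 with hg
  have hF : FourierTransform.fourier f = fun w => 2 * g (2 * π * w) := by
    ext w
    rw [Real.fourier_real_eq_integral_exp_smul, hg, hf,
      ← integral_exp_mul_abs_mul_exp_neg_abs ha _ (hz _)]
    congr with s
    rw [smul_eq_mul]
    push_cast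
    ring_nf
  have h2π : (2 * π : ℝ) ≠ 0 := by positivity
  have hinv := Continuous.fourierInv_fourier_eq (f := f) (by fun_prop)
    (integrable_abs_mul_exp_neg_abs ha)
    (by
      rw [hF]
      exact ((integrable_sub_sq_div_sq_add_sq hz).comp_mul_left' h2π).const_mul 2)
  have h := congrFun hinv (-r)
  rw [Real.fourierInv_eq', hF] at h
  have hcomp := Measure.integral_comp_mul_left
    (fun t : ℝ => Complex.exp (-(r * t : ℝ) * Complex.I) * g t) (2 * π)
  have hlhs : ∀ w : ℝ, Complex.exp ((2 * π * inner ℝ w (-r) : ℝ) * Complex.I) •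
      (2 * g (2 * π * w)) =
      2 * (Complex.exp (-(r * (2 * π * w) : ℝ) * Complex.I) * g (2 * π * w)) := by
    intro w
    rw [smul_eq_mul, mul_left_comm]
    congr 3
    simp
    ring
  simp_rw [hlhs] at h
  rw [integral_const_mul, hcomp, abs_of_pos (by positivity)] at h
  have hfr : f (-r) = f r := by simp [hf]
  rw [hfr, Complex.real_smul] at h
  change _ = π * f r
  rw [← h]
  have hπ : (π : ℂ) ≠ 0 := by exact_mod_cast Real.pi_ne_zero
  rw [Complex.ofReal_inv, Complex.ofReal_mul, Complex.ofReal_ofNat, ← mul_assoc, ← mul_assoc,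
    show (π : ℂ) * 2 * (2 * (π : ℂ))⁻¹ = 1 by field_simp, one_mul]

lemma integral_closedBall_eq_intervalIntegral {z : ℂ} (hz : z ∈ Complex.slitPlane) {x : E3}
    (hx : x ≠ 0) {R : ℝ} (hR : 0 ≤ R) :
    ∫ y in Metric.closedBall (0 : E3) R,
        Complex.exp (-Complex.I * ((∑ i, x i * y i : ℝ) : ℂ)) / (((‖y‖ : ℝ) : ℂ) ^ 2 + z) =
      ∫ t : ℝ in -R..R, Complex.exp (-(‖x‖ * t : ℝ) * Complex.I) *
        (π * (Complex.log ((R : ℂ) ^ 2 + z) - Complex.log ((t : ℂ) ^ 2 + z))) := by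
  obtain ⟨e, he, hcoord⟩ := exists_measurableEquiv_cylindrical x hx
  let F : ℝ × EuclideanSpace ℝ (Fin 2) → ℂ := fun p =>
    Complex.exp (-(‖x‖ * p.1 : ℝ) * Complex.I) *
      (if p.1 ^ 2 + ‖p.2‖ ^ 2 ≤ R ^ 2 then 1 / (((p.1 ^ 2 + ‖p.2‖ ^ 2 : ℝ) : ℂ) + z) else 0)
  have hF : (Metric.closedBall (0 : E3) R).indicator (fun y =>
      Complex.exp (-Complex.I * ((∑ i, x i * y i : ℝ) : ℂ)) / (((‖y‖ : ℝ) : ℂ) ^ 2 + z)) =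
      F ∘ e := by
    ext y
    have hy : y ∈ Metric.closedBall (0 : E3) R ↔ (e y).1 ^ 2 + ‖(e y).2‖ ^ 2 ≤ R ^ 2 := by
      rw [← (hcoord y).2, mem_closedBall_zero_iff, sq_le_sq₀ (norm_nonneg y) hR]
    simp only [F, Set.indicator_apply, hy, Function.comp_apply, (hcoord y).1, ← Complex.ofReal_pow,
      (hcoord y).2]
    split_ifs
    · rw [mul_one_div]
      ring_nf
    · simp
  have hint : Integrable F := by
    rw [← he.integrable_comp_emb e.measurableEmbedding, ← hF,
      integrable_indicator_iff Metric.isClosed_closedBall.measurableSet]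
    refine ContinuousOn.integrableOn_compact (isCompact_closedBall _ _) ?_
    exact (Continuous.div₀ (by fun_prop) (by fun_prop)
      fun y => sq_add_ne_zero hz ‖y‖).continuousOn
  rw [← integral_indicator Metric.isClosed_closedBall.measurableSet, hF]
  simp only [Function.comp_def]
  rw [he.integral_comp e.measurableEmbedding F, Measure.volume_eq_prod, integral_prod F hint,
    intervalIntegral.integral_of_le (by linarith), ← integral_Icc_eq_integral_Ioc,
    ← integral_indicator measurableSet_Icc]
  congr with t
  have ht : t ∈ Set.Icc (-R) R ↔ t ^ 2 ≤ R ^ 2 := by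
    rw [sq_le_sq, abs_of_nonneg hR, abs_le, Set.mem_Icc]
  simp only [F, integral_const_mul, integral_disc_inv_norm_sq_add hz (sq_nonneg t),
    Set.indicator_apply, ht]
  split_ifs <;> simp

lemma hasDerivAt_exp_neg_mul_I (r t : ℝ) :
    HasDerivAt (fun t : ℝ => Complex.exp (-(r * t : ℝ) * Complex.I))
      (-(r * Complex.I) * Complex.exp (-(r * t : ℝ) * Complex.I)) t := by
  have h1 : HasDerivAt (fun t : ℝ => (t : ℂ)) 1 t := Complex.ofRealCLM.hasDerivAt
  have h2 := (h1.const_mul (-(r * Complex.I))).cexp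
  convert! h2 using 1
  · ext t
    push_cast
    ring_nf
  · push_cast
    ring_nf

lemma integral_exp_mul_eq_by_parts {r : ℝ} (hr : r ≠ 0) {v v' : ℝ → ℂ}
    (hv : ∀ t, HasDerivAt v (v' t) t) (hv' : Continuous v') (a b : ℝ) :
    ∫ t : ℝ in a..b, Complex.exp (-(r * t : ℝ) * Complex.I) * v t =
      Complex.I / r * (Complex.exp (-(r * b : ℝ) * Complex.I) * v b -
        Complex.exp (-(r * a : ℝ) * Complex.I) * v a -
        ∫ t : ℝ in a..b, Complex.exp (-(r * t : ℝ) * Complex.I) * v' t) := by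
  have hr' : (r : ℂ) ≠ 0 := by exact_mod_cast hr
  have hvc : Continuous v := continuous_iff_continuousAt.mpr fun t => (hv t).continuousAt
  rw [intervalIntegral.integral_mul_deriv_eq_deriv_mul (fun t _ => hasDerivAt_exp_neg_mul_I r t)
    (fun t _ => hv t) (Continuous.intervalIntegrable (by fun_prop) _ _)
    (hv'.intervalIntegrable _ _)]
  simp_rw [mul_assoc (-(r * Complex.I))]
  rw [intervalIntegral.integral_const_mul]
  rw [_root_.sub_sub_cancel, ← mul_assoc, show Complex.I / r * -(r * Complex.I) = 1 by
    field_simp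
    simp, one_mul]

lemma tendsto_id_div_sq_add_atTop (z : ℂ) :
    Tendsto (fun R : ℝ => (R : ℂ) / ((R : ℂ) ^ 2 + z)) atTop (nhds 0) := by
  have h1 : Tendsto (fun R : ℝ => ((R⁻¹ : ℝ) : ℂ)) atTop (nhds 0) := by
    rw [← Complex.ofReal_zero]
    exact (Complex.continuous_ofReal.tendsto 0).comp tendsto_inv_atTop_zero
  have h2 : Tendsto (fun R : ℝ => ((R⁻¹ : ℝ) : ℂ) / (1 + z * ((R⁻¹ : ℝ) : ℂ) ^ 2)) atTop
      (nhds (0 / (1 + z * 0 ^ 2))) :=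
    h1.div (((h1.pow 2).const_mul z).const_add 1) (by simp)
  simp only [zero_div] at h2
  refine h2.congr' ?_
  filter_upwards [eventually_gt_atTop 0] with R hR
  have hR' : (R : ℂ) ≠ 0 := by exact_mod_cast hR.ne'
  push_cast
  field_simp

lemma integral_closedBall_eq_by_parts {z : ℂ} (hz : z ∈ Complex.slitPlane) {x : E3}
    (hx : x ≠ 0) {R : ℝ} (hR : 0 ≤ R) :
    ∫ y in Metric.closedBall (0 : E3) R,
        Complex.exp (-Complex.I * ((∑ i, x i * y i : ℝ) : ℂ)) / (((‖y‖ : ℝ) : ℂ) ^ 2 + z) =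
      2 * π / ‖x‖ ^ 2 * ((∫ t : ℝ in -R..R, Complex.exp (-(‖x‖ * t : ℝ) * Complex.I) *
          ((z - (t : ℂ) ^ 2) / ((t : ℂ) ^ 2 + z) ^ 2)) -
        (Complex.exp (-(‖x‖ * R : ℝ) * Complex.I) +
          Complex.exp (-(‖x‖ * -R : ℝ) * Complex.I)) * (R / ((R : ℂ) ^ 2 + z))) := by
  have hr : ‖x‖ ≠ 0 := norm_ne_zero_iff.mpr hx
  have hr' : (‖x‖ : ℂ) ≠ 0 := by exact_mod_cast hr
  have hne := sq_add_ne_zero hz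
  have hd1 (t : ℝ) : HasDerivAt (fun t : ℝ => (π : ℂ) *
      (Complex.log ((R : ℂ) ^ 2 + z) - Complex.log ((t : ℂ) ^ 2 + z)))
      (-2 * π * (t / ((t : ℂ) ^ 2 + z))) t :=
    (((hasDerivAt_log_sq_add hz t).const_sub _).const_mul _).congr_deriv (by ring)
  have hd2 (t : ℝ) : HasDerivAt (fun t : ℝ => -2 * π * ((t : ℂ) / ((t : ℂ) ^ 2 + z)))
      (-2 * π * ((z - (t : ℂ) ^ 2) / ((t : ℂ) ^ 2 + z) ^ 2)) t := by
    have h1 : HasDerivAt (fun t : ℝ => (t : ℂ)) 1 t := Complex.ofRealCLM.hasDerivAt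
    refine ((h1.div ((h1.pow 2).add_const z) (hne t)).const_mul (-2 * π : ℂ)).congr_deriv ?_
    simp
    ring
  have hc1 : Continuous fun t : ℝ => -2 * π * ((t : ℂ) / ((t : ℂ) ^ 2 + z)) :=
    continuous_iff_continuousAt.mpr fun t => (hd2 t).continuousAt
  have hc2 : Continuous fun t : ℝ => -2 * π * ((z - (t : ℂ) ^ 2) / ((t : ℂ) ^ 2 + z) ^ 2) :=
    continuous_const.mul (Continuous.div₀ (by fun_prop) (by fun_prop)
      fun t => pow_ne_zero 2 (hne t))
  rw [integral_closedBall_eq_intervalIntegral hz hx hR, integral_exp_mul_eq_by_parts hr hd1 hc1,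
    integral_exp_mul_eq_by_parts hr hd2 hc2]
  simp_rw [mul_left_comm _ (-2 * π : ℂ)]
  rw [intervalIntegral.integral_const_mul]
  push_cast
  simp only [neg_sq, sub_self, mul_zero, zero_sub]
  field_simp
  simp only [Complex.I_sq]
  ring

lemma re_cpow_half_pos {z : ℂ} (hz : z ∈ Complex.slitPlane) : 0 < (z ^ ((1 : ℂ) / 2)).re := by
  have harg := Complex.mem_slitPlane_iff_arg.mp hz
  have hlt : z.arg < π := lt_of_le_of_ne (Complex.arg_le_pi z) harg.1
  have hgt := Complex.neg_pi_lt_arg z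
  rw [Complex.cpow_def_of_ne_zero harg.2, Complex.exp_re]
  refine mul_pos (Real.exp_pos _) (Real.cos_pos_of_mem_Ioo ?_)
  have him : (Complex.log z * (1 / 2)).im = z.arg / 2 := by
    rw [one_div, ← div_eq_mul_inv, Complex.div_ofNat_im, Complex.log_im]
  rw [him]
  constructor <;> linarith

/-- Fourier transform of `1/(|y|² + z)` in `ℝ³`:
`lim_{R→∞} ∫_{|y|≤R} e^{−ix·y}/(|y|²+z) dy = 2π² e^{−√z|x|}/|x|`. -/
theorem stmt16 :
    ∀ z : ℂ, ¬(z.im = 0 ∧ z.re ≤ 0) →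
      ∀ x : E3, x ≠ 0 →
        Tendsto (fun R : ℝ =>
            ∫ y in Metric.closedBall (0 : E3) R,
              Complex.exp (-Complex.I * ((∑ i, x i * y i : ℝ) : ℂ)) /
                (((‖y‖ : ℝ) : ℂ) ^ 2 + z))
          atTop
          (nhds (2 * (π : ℂ) ^ 2 *
            Complex.exp (-(z ^ ((1 : ℂ)/2)) * ((‖x‖ : ℝ) : ℂ)) / ((‖x‖ : ℝ) : ℂ))) := by

  intro z hz x hx
  have hz' : z ∈ Complex.slitPlane := by
    rw [Complex.mem_slitPlane_iff]
    by_contra! h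
    exact hz ⟨h.2, h.1⟩
  set a : ℂ := z ^ ((1 : ℂ) / 2) with ha_def
  have hsq : a ^ 2 = z := by
    rw [ha_def, one_div]
    exact Complex.cpow_nat_inv_pow z two_ne_zero
  have ha : 0 < a.re := re_cpow_half_pos hz'
  have hne : ∀ t : ℝ, (t : ℂ) ^ 2 + a ^ 2 ≠ 0 := by rw [hsq]; exact sq_add_ne_zero hz'
  have hr' : (‖x‖ : ℂ) ≠ 0 := by simpa using hx
  have hint : Integrable fun t : ℝ => Complex.exp (-(‖x‖ * t : ℝ) * Complex.I) *
      ((z - (t : ℂ) ^ 2) / ((t : ℂ) ^ 2 + z) ^ 2) := by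
    refine (integrable_sub_sq_div_sq_add_sq (sq_add_ne_zero hz')).bdd_mul (c := 1) (by fun_prop)
      (.of_forall fun t => ?_)
    rw [← Complex.ofReal_neg, Complex.norm_exp_ofReal_mul_I]
  have hlim := intervalIntegral_tendsto_integral hint tendsto_neg_atTop_atBot tendsto_id
  have hval := integral_exp_mul_sub_sq_div_sq_add_sq ha hne ‖x‖
  rw [hsq, abs_norm] at hval
  rw [hval] at hlim
  have hbdry : Tendsto (fun R : ℝ => (Complex.exp (-(‖x‖ * R : ℝ) * Complex.I) +
      Complex.exp (-(‖x‖ * -R : ℝ) * Complex.I)) * (R / ((R : ℂ) ^ 2 + z))) atTop (nhds 0) := by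
    refine isBoundedUnder_le_mul_tendsto_zero (isBoundedUnder_of ⟨2, fun R => ?_⟩)
      (tendsto_id_div_sq_add_atTop z)
    refine (norm_add_le _ _).trans ?_
    simp [Complex.norm_exp]
    norm_num
  have h := (hlim.sub hbdry).const_mul (2 * π / (‖x‖ : ℂ) ^ 2)
  have heq : 2 * (π : ℂ) ^ 2 * Complex.exp (-a * ((‖x‖ : ℝ) : ℂ)) / ((‖x‖ : ℝ) : ℂ) =
      2 * π / (‖x‖ : ℂ) ^ 2 * (π * (‖x‖ * Complex.exp (-a * ‖x‖)) - 0) := by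
    field_simp
    ring
  rw [heq]
  refine h.congr' ?_
  filter_upwards [eventually_ge_atTop 0] with R hR
  exact (integral_closedBall_eq_by_parts hz' hx hR).symm
end
end
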